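/- For every ε > 0 and every Δ ≥ 3, if p = p(n) satisfies p·n^{1/(Δ−1)}/(log n)^5 → ∞, then a.a.s. G(n,p) is universal for 𝓗((1−ε)n, Δ), i.e. G(n,p) simultaneously contains a copy of every graph on at most (1−ε)n vertices with maximum degree at most Δ. -/

import Mathlib

open MeasureTheory Filter Topology

/-- Bernoulli measure on `Bool` with success probability `p` (clamped to `[0,1]`). -/
noncomputable def bernoulliMeasure (p : ℝ) : Measure Bool :=
  (min (ENNReal.ofReal p) 1) • Measure.dirac true +
    (1 - min (ENNReal.ofReal p) 1) • Measure.dirac false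

/-- The distribution of the binomial random graph `G(n,p)`, as a product of independent
Bernoulli measures, one for each potential edge. -/
noncomputable def gnp (n : ℕ) (p : ℝ) : Measure (Sym2 (Fin n) → Bool) :=
  Measure.pi fun _ => bernoulliMeasure p

/-- The simple graph on `[n]` determined by an outcome of the edge indicators. -/
def graphOf {n : ℕ} (ω : Sym2 (Fin n) → Bool) : SimpleGraph (Fin n) :=
  SimpleGraph.fromRel fun u v => ω s(u, v) = true

/-- `G` contains a (not necessarily induced) copy of `H`. -/
def ContainsCopy {α β : Type*} (H : SimpleGraph α) (G : SimpleGraph β) : Prop :=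
  ∃ f : α → β, Function.Injective f ∧ ∀ ⦃u v⦄, H.Adj u v → G.Adj (f u) (f v)

/-- The maximum degree of a graph on a finite vertex type. -/
noncomputable def maxDeg {V : Type*} [Fintype V] (G : SimpleGraph V) : ℕ :=
  Finset.univ.sup fun v => (G.neighborSet v).ncard

/-- The maximum 0-density `m₀(H)`. -/
noncomputable def m0 {V : Type*} [Fintype V] (H : SimpleGraph V) : ℝ :=
  sSup {x : ℝ | ∃ H' : H.Subgraph, H'.verts.Nonempty ∧
    x = (H'.edgeSet.ncard : ℝ) / (H'.verts.ncard : ℝ)}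

/-- The maximum 1-density `m₁(H)`. -/
noncomputable def m1 {V : Type*} [Fintype V] (H : SimpleGraph V) : ℝ :=
  sSup {x : ℝ | ∃ H' : H.Subgraph, 1 < H'.verts.ncard ∧
    x = (H'.edgeSet.ncard : ℝ) / ((H'.verts.ncard : ℝ) - 1)}

/-- The maximum 2-density `m₂(H)`. -/
noncomputable def m2 {V : Type*} [Fintype V] (H : SimpleGraph V) : ℝ :=
  sSup {x : ℝ | ∃ H' : H.Subgraph, 0 < H'.edgeSet.ncard ∧
    x = if 2 < H'.verts.ncard
      then ((H'.edgeSet.ncard : ℝ) - 1) / ((H'.verts.ncard : ℝ) - 2)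
      else 1 / 2}

/-- The maximum Riordan-density `m_R(H)`. -/
noncomputable def mR {V : Type*} [Fintype V] (H : SimpleGraph V) : ℝ :=
  sSup {x : ℝ | ∃ H' : H.Subgraph, 2 < H'.verts.ncard ∧
    x = (H'.edgeSet.ncard : ℝ) / ((H'.verts.ncard : ℝ) - 2)}

/-- The local 1-density `m₁(x,H)` of `H` at the vertex `x`. -/
noncomputable def m1At {V : Type*} [Fintype V] (H : SimpleGraph V) (x : V) : ℝ :=
  sSup {r : ℝ | ∃ H' : H.Subgraph, x ∈ H'.verts ∧ 1 < H'.verts.ncard ∧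
    r = (H'.edgeSet.ncard : ℝ) / ((H'.verts.ncard : ℝ) - 1)}

/-- `H` is strictly 1-balanced: `H` itself is the unique maximiser of the 1-density. -/
def StrictlyOneBalanced {V : Type*} [Fintype V] (H : SimpleGraph V) : Prop :=
  ∀ H' : H.Subgraph, 1 < H'.verts.ncard → H' ≠ ⊤ →
    (H'.edgeSet.ncard : ℝ) / ((H'.verts.ncard : ℝ) - 1) <
      (H.edgeSet.ncard : ℝ) / ((Fintype.card V : ℝ) - 1)

/-- `H` is vertex-1-balanced: the local 1-density at every vertex equals `m₁(H)`. -/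
def VertexOneBalanced {V : Type*} [Fintype V] (H : SimpleGraph V) : Prop :=
  ∀ x : V, m1At H x = m1 H

/-- `G` (an `n`-vertex graph) contains an `H`-factor: `⌊n / v(H)⌋` pairwise vertex-disjoint
copies of `H`. -/
def HasFactor {V : Type*} [Fintype V] (H : SimpleGraph V) {n : ℕ}
    (G : SimpleGraph (Fin n)) : Prop :=
  ∃ f : Fin (n / Fintype.card V) × V → Fin n, Function.Injective f ∧
    ∀ (i : Fin (n / Fintype.card V)) ⦃u v : V⦄, H.Adj u v → G.Adj (f (i, u)) (f (i, v))

section PartA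

open MeasureTheory Filter Topology

set_option linter.unusedSectionVars false

/-! ### Finite product probability and a Janson-type inequality -/

section Prob
variable {E : Type*} [Fintype E] [DecidableEq E]

/-- Weight of one coordinate. -/
noncomputable def bw (p : ℝ) (b : Bool) : ℝ := if b = true then p else 1 - p

/-- Weight of an outcome. -/
noncomputable def Wt (p : ℝ) (ω : E → Bool) : ℝ := ∏ e, bw p (ω e)

/-- Expectation. -/
noncomputable def Ex (p : ℝ) (f : (E → Bool) → ℝ) : ℝ := ∑ ω, Wt p ω * f ω

/-- Indicator that all coordinates in `F` are true. -/
noncomputable def ind (F : Finset E) (ω : E → Bool) : ℝ := if ∀ e ∈ F, ω e = true then 1 else 0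

lemma bw_nonneg {p : ℝ} (h0 : 0 ≤ p) (h1 : p ≤ 1) (b : Bool) : 0 ≤ bw p b := by
  unfold bw; split_ifs <;> linarith

lemma Wt_nonneg {p : ℝ} (h0 : 0 ≤ p) (h1 : p ≤ 1) (ω : E → Bool) : 0 ≤ Wt p ω :=
  Finset.prod_nonneg fun _ _ => bw_nonneg h0 h1 _

lemma sum_Wt (p : ℝ) : ∑ ω : E → Bool, Wt p ω = 1 := by
  unfold Wt
  rw [← Fintype.prod_sum]
  simp [bw]

lemma Ex_one (p : ℝ) : Ex (E := E) p (fun _ => 1) = 1 := by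
  unfold Ex; simp [sum_Wt]

lemma Ex_mono {p : ℝ} (h0 : 0 ≤ p) (h1 : p ≤ 1) {f g : (E → Bool) → ℝ} (h : ∀ ω, f ω ≤ g ω) :
    Ex p f ≤ Ex p g :=
  Finset.sum_le_sum fun ω _ => mul_le_mul_of_nonneg_left (h ω) (Wt_nonneg h0 h1 ω)

lemma Ex_sub (p : ℝ) (f g : (E → Bool) → ℝ) : Ex p (fun ω => f ω - g ω) = Ex p f - Ex p g := by
  unfold Ex; simp [mul_sub]

lemma Ex_smul (p c : ℝ) (f : (E → Bool) → ℝ) : Ex p (fun ω => c * f ω) = c * Ex p f := by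
  unfold Ex; rw [Finset.mul_sum]; exact Finset.sum_congr rfl fun _ _ => by ring

lemma Ex_sum {κ : Type*} (p : ℝ) (s : Finset κ) (f : κ → (E → Bool) → ℝ) :
    Ex p (fun ω => ∑ a ∈ s, f a ω) = ∑ a ∈ s, Ex p (f a) := by
  unfold Ex; simp_rw [Finset.mul_sum]; rw [Finset.sum_comm]

lemma Ex_nonneg {p : ℝ} (h0 : 0 ≤ p) (h1 : p ≤ 1) {f : (E → Bool) → ℝ} (h : ∀ ω, 0 ≤ f ω) :
    0 ≤ Ex p f :=
  Finset.sum_nonneg fun ω _ => mul_nonneg (Wt_nonneg h0 h1 ω) (h ω)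

lemma ind_nonneg (F : Finset E) (ω : E → Bool) : 0 ≤ ind F ω := by
  unfold ind; split_ifs <;> norm_num

lemma ind_le_one (F : Finset E) (ω : E → Bool) : ind F ω ≤ 1 := by
  unfold ind; split_ifs <;> norm_num

lemma ind_mul (F F' : Finset E) (ω : E → Bool) : ind F ω * ind F' ω = ind (F ∪ F') ω := by
  unfold ind
  have : (∀ e ∈ F ∪ F', ω e = true) ↔ (∀ e ∈ F, ω e = true) ∧ (∀ e ∈ F', ω e = true) := by
    simp only [Finset.mem_union, or_imp, forall_and]
  simp only [this, ite_zero_mul_ite_zero, mul_one]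

lemma ind_mono (F : Finset E) : Monotone (ind F) := by
  intro ω ω' h
  unfold ind
  by_cases h1 : ∀ e ∈ F, ω e = true
  · rw [if_pos h1, if_pos]
    intro e he
    have := h e
    rw [h1 e he] at this
    exact top_le_iff.1 this
  · rw [if_neg h1]; split_ifs <;> norm_num

/-- flipping one coordinate -/
def flipAt (e : E) (ω : E → Bool) : E → Bool := Function.update ω e (!(ω e))

lemma flipAt_invol (e : E) : Function.Involutive (flipAt e) := by
  intro ω; unfold flipAt; simp

lemma Wt_update (p : ℝ) (e : E) (ω : E → Bool) (b : Bool) :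
    Wt p (Function.update ω e b) = bw p b * ∏ x ∈ Finset.univ.erase e, bw p (ω x) := by
  unfold Wt
  rw [← Finset.mul_prod_erase _ _ (Finset.mem_univ e)]
  simp only [Function.update_self]
  congr 1
  refine Finset.prod_congr rfl fun x hx => ?_
  rw [Function.update_of_ne (Finset.ne_of_mem_erase hx)]

lemma Ex_ind_single (p : ℝ) (e : E) (h : (E → Bool) → ℝ)
    (hh : ∀ ω b, h (Function.update ω e b) = h ω) :
    Ex p (fun ω => ind {e} ω * h ω) = p * Ex p h := by
  have key : ∑ ω, (1 - p) * (Wt p ω * (ind {e} ω * h ω))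
      = ∑ ω, p * (Wt p ω * ((1 - ind {e} ω) * h ω)) := by
    refine Fintype.sum_equiv ((flipAt_invol e).toPerm (flipAt e)) _ _ fun ω => ?_
    have h1 : (flipAt_invol e).toPerm (flipAt e) ω = Function.update ω e (!(ω e)) := rfl
    rw [h1, hh, Wt_update]
    have h2 := Wt_update p e ω (ω e)
    rw [Function.update_eq_self] at h2
    rw [h2]
    unfold ind
    cases hb : ω e <;> simp [hb, bw] <;> ring
  rw [← Finset.mul_sum, ← Finset.mul_sum] at key
  have h3 : ∑ ω, Wt p ω * ((1 - ind {e} ω) * h ω) = Ex p h - Ex p (fun ω => ind {e} ω * h ω) := by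
    rw [← Ex_sub]; unfold Ex; exact Finset.sum_congr rfl fun _ _ => by ring
  rw [h3] at key
  change (1 - p) * Ex p (fun ω => ind {e} ω * h ω) = _ at key
  linarith

lemma Ex_ind_mul (p : ℝ) (F : Finset E) (h : (E → Bool) → ℝ)
    (hh : ∀ e ∈ F, ∀ ω b, h (Function.update ω e b) = h ω) :
    Ex p (fun ω => ind F ω * h ω) = p ^ F.card * Ex p h := by
  induction F using Finset.induction_on with
  | empty => simp [ind]
  | insert e F he ih =>
    have : (fun ω => ind (insert e F) ω * h ω) = fun ω => ind {e} ω * (ind F ω * h ω) := by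
      funext ω
      rw [← mul_assoc, ind_mul, Finset.insert_eq]
    rw [this, Ex_ind_single, ih fun e' he' => hh e' (Finset.mem_insert_of_mem he'),
      Finset.card_insert_of_notMem he]
    · ring
    · intro ω b
      rw [hh e (Finset.mem_insert_self _ _)]
      congr 1
      unfold ind
      congr 1
      apply propext
      refine forall₂_congr fun x hx => ?_
      rw [Function.update_of_ne]
      rintro rfl
      exact he hx

lemma Ex_ind (p : ℝ) (F : Finset E) : Ex p (ind F) = p ^ F.card := by
  have := Ex_ind_mul p F (fun _ => 1) (fun _ _ _ _ => rfl)
  rw [Ex_one] at this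
  simpa using this

lemma harris {p : ℝ} (h0 : 0 ≤ p) (h1 : p ≤ 1) (f g : (E → Bool) → ℝ) (hf0 : ∀ ω, 0 ≤ f ω)
    (hf : Monotone f) (hg : Antitone g) (hg1 : ∀ ω, g ω ≤ 1) :
    Ex p (fun ω => f ω * g ω) ≤ Ex p f * Ex p g := by
  have := fkg (α := E → Bool) (β := ℝ) (μ := Wt p) (f := f) (g := fun ω => 1 - g ω)
    (fun ω => Wt_nonneg h0 h1 ω) hf0 (fun ω => by simpa using hg1 ω)
    hf (fun a b hab => sub_le_sub_left (hg hab) 1) ?_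
  · rw [sum_Wt, one_mul] at this
    change Ex p f * Ex p (fun ω => 1 - g ω) ≤ Ex p (fun ω => f ω * (1 - g ω)) at this
    rw [Ex_sub, Ex_one] at this
    have h2 : Ex p (fun ω => f ω * (1 - g ω)) = Ex p f - Ex p (fun ω => f ω * g ω) := by
      rw [← Ex_sub]; congr 1; funext ω; ring
    rw [h2] at this
    linarith
  · intro a b
    unfold Wt
    rw [← Finset.prod_mul_distrib, ← Finset.prod_mul_distrib]
    refine le_of_eq (Finset.prod_congr rfl fun e _ => ?_)
    simp only [Pi.inf_apply, Pi.sup_apply]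
    cases a e <;> cases b e <;> simp [bw, mul_comm]

/-- The thinned avoidance product. -/
noncomputable def Dp {κ : Type*} (F : κ → Finset E) (q : κ → ℝ) (S : Finset κ) (ω : E → Bool) : ℝ :=
  ∏ a ∈ S, (1 - q a * ind (F a) ω)

lemma fac_nonneg {q : ℝ} (hq0 : 0 ≤ q) (hq : q ≤ 1) (F : Finset E) (ω : E → Bool) :
    0 ≤ 1 - q * ind F ω := by
  have := ind_le_one F ω
  have := ind_nonneg F ω
  nlinarith

lemma fac_le_one {q : ℝ} (hq0 : 0 ≤ q) (F : Finset E) (ω : E → Bool) :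
    1 - q * ind F ω ≤ 1 := by
  have := mul_nonneg hq0 (ind_nonneg F ω)
  linarith

lemma one_sub_sum_le_prod {κ : Type*} (S : Finset κ) (z : κ → ℝ) (h0 : ∀ a ∈ S, 0 ≤ z a)
    (h1 : ∀ a ∈ S, z a ≤ 1) : 1 - ∑ a ∈ S, z a ≤ ∏ a ∈ S, (1 - z a) := by
  classical
  induction S using Finset.induction_on with
  | empty => simp
  | insert a S ha ih =>
    rw [Finset.sum_insert ha, Finset.prod_insert ha]
    have ih' := ih (fun b hb => h0 b (Finset.mem_insert_of_mem hb))
      (fun b hb => h1 b (Finset.mem_insert_of_mem hb))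
    have ha0 := h0 a (Finset.mem_insert_self _ _)
    have ha1 := h1 a (Finset.mem_insert_self _ _)
    have hs : 0 ≤ ∑ a ∈ S, z a := Finset.sum_nonneg fun b hb => h0 b (Finset.mem_insert_of_mem hb)
    nlinarith

lemma janson {κ : Type*} [DecidableEq κ] {p : ℝ} (h0 : 0 ≤ p) (h1 : p ≤ 1)
    (F : κ → Finset E) (q : κ → ℝ)
    (hq0 : ∀ a, 0 ≤ q a) (hq1 : ∀ a, q a ≤ 1) (S : Finset κ) :
    Ex p (Dp F q S) ≤ Real.exp (-(∑ a ∈ S, q a * p ^ (F a).card) +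
      ∑ a ∈ S, ∑ b ∈ S.filter (fun b => ¬ Disjoint (F a) (F b)),
        q a * q b * p ^ (F a ∪ F b).card) := by
  induction S using Finset.induction_on with
  | empty =>
    have : Dp F q ∅ = fun _ => 1 := by funext ω; simp [Dp]
    rw [this, Ex_one]; simp
  | insert i S hi ih =>
    set near := S.filter (fun b => ¬ Disjoint (F i) (F b)) with hnear
    set far := S.filter (fun b => Disjoint (F i) (F b)) with hfar
    have hDpos : ∀ T ω, 0 ≤ Dp F q T ω := fun T ω =>
      Finset.prod_nonneg fun a _ => fac_nonneg (hq0 a) (hq1 a) _ _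
    have hDle : ∀ T ω, Dp F q T ω ≤ 1 := fun T ω =>
      Finset.prod_le_one (fun a _ => fac_nonneg (hq0 a) (hq1 a) _ _)
        (fun a _ => fac_le_one (hq0 a) _ _)
    have hanti : Antitone (Dp F q far) := by
      intro ω ω' hω
      unfold Dp
      refine Finset.prod_le_prod (fun a _ => fac_nonneg (hq0 a) (hq1 a) _ _) fun a _ => ?_
      have := mul_le_mul_of_nonneg_left (ind_mono (F a) hω) (hq0 a)
      linarith
    have hsplit : ∀ ω, Dp F q S ω = Dp F q far ω * Dp F q near ω := fun ω => by
      unfold Dp; rw [hfar, hnear, Finset.prod_filter_mul_prod_filter_not]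
    have hfarS : Ex p (Dp F q S) ≤ Ex p (Dp F q far) := Ex_mono h0 h1 fun ω => by
      rw [hsplit]; exact mul_le_of_le_one_right (hDpos _ _) (hDle _ _)
    set c := p ^ (F i).card - ∑ a ∈ near, q a * p ^ (F i ∪ F a).card with hc
    -- main lower bound
    have hmain : c * Ex p (Dp F q far) ≤ Ex p (fun ω => ind (F i) ω * Dp F q S ω) := by
      have e1 : Ex p (fun ω => ind (F i) ω * Dp F q far ω)
          = p ^ (F i).card * Ex p (Dp F q far) := by
        refine Ex_ind_mul p _ _ fun e he ω b => ?_
        unfold Dp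
        refine Finset.prod_congr rfl fun a ha => ?_
        have hd : Disjoint (F i) (F a) := (Finset.mem_filter.1 ha).2
        congr 2
        unfold ind
        congr 1
        apply propext
        refine forall₂_congr fun x hx => ?_
        rw [Function.update_of_ne]
        rintro rfl
        exact Finset.disjoint_left.1 hd he hx
      have e2 : ∀ a, Ex p (fun ω => ind (F i ∪ F a) ω * Dp F q far ω)
          ≤ p ^ (F i ∪ F a).card * Ex p (Dp F q far) := fun a => by
        rw [← Ex_ind]
        exact harris h0 h1 _ _ (ind_nonneg _) (ind_mono _) hanti (hDle _)
      have e3 : Ex p (fun ω => ind (F i) ω * Dp F q far ω -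
          ∑ a ∈ near, q a * (ind (F i ∪ F a) ω * Dp F q far ω))
          ≤ Ex p (fun ω => ind (F i) ω * Dp F q S ω) := by
        refine Ex_mono h0 h1 fun ω => ?_
        have h5 : 1 - ∑ a ∈ near, q a * ind (F a) ω ≤ Dp F q near ω :=
          one_sub_sum_le_prod near _ (fun a _ => mul_nonneg (hq0 a) (ind_nonneg _ _))
            (fun a _ => by have := fac_nonneg (hq0 a) (hq1 a) (F a) ω; linarith)
        have h6 : 0 ≤ ind (F i) ω * Dp F q far ω := mul_nonneg (ind_nonneg _ _) (hDpos _ _)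
        have h7 := mul_le_mul_of_nonneg_left h5 h6
        have h8 : ∑ a ∈ near, q a * (ind (F i ∪ F a) ω * Dp F q far ω) =
            ind (F i) ω * Dp F q far ω * ∑ a ∈ near, q a * ind (F a) ω := by
          rw [Finset.mul_sum]
          refine Finset.sum_congr rfl fun a _ => ?_
          rw [← ind_mul]; ring
        rw [h8, hsplit]
        nlinarith
      refine le_trans ?_ e3
      rw [Ex_sub, e1, Ex_sum, hc, sub_mul, Finset.sum_mul]
      refine sub_le_sub_left (Finset.sum_le_sum fun a _ => ?_) _
      rw [Ex_smul, mul_assoc]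
      exact mul_le_mul_of_nonneg_left (e2 a) (hq0 a)
    have hmain2 : c * Ex p (Dp F q S) ≤ Ex p (fun ω => ind (F i) ω * Dp F q S ω) := by
      rcases le_or_gt 0 c with hc0 | hc0
      · exact le_trans (mul_le_mul_of_nonneg_left hfarS hc0) hmain
      · refine le_trans (mul_nonpos_of_nonpos_of_nonneg hc0.le (Ex_nonneg h0 h1 (hDpos S))) ?_
        exact Ex_nonneg h0 h1 fun ω => mul_nonneg (ind_nonneg _ _) (hDpos _ _)
    have hstep : Ex p (Dp F q (insert i S)) ≤ Real.exp (-(q i * c)) * Ex p (Dp F q S) := by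
      have : Dp F q (insert i S) = fun ω => Dp F q S ω - q i * (ind (F i) ω * Dp F q S ω) := by
        funext ω; unfold Dp; rw [Finset.prod_insert hi]; ring
      rw [this, Ex_sub, Ex_smul]
      have h9 := mul_le_mul_of_nonneg_left hmain2 (hq0 i)
      have h10 := Real.add_one_le_exp (-(q i * c))
      have h11 := Ex_nonneg h0 h1 (hDpos S)
      nlinarith
    refine hstep.trans ?_
    refine (mul_le_mul_of_nonneg_left ih (Real.exp_pos _).le).trans ?_
    rw [← Real.exp_add]
    apply Real.exp_le_exp.2
    rw [Finset.sum_insert hi, Finset.sum_insert hi]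
    have hnn : ∀ a b, 0 ≤ q a * q b * p ^ (F a ∪ F b).card := fun a b =>
      mul_nonneg (mul_nonneg (hq0 a) (hq0 b)) (pow_nonneg h0 _)
    have k1 : ∑ a ∈ near, q i * q a * p ^ (F i ∪ F a).card ≤
        ∑ b ∈ (insert i S).filter (fun b => ¬ Disjoint (F i) (F b)),
          q i * q b * p ^ (F i ∪ F b).card := by
      refine Finset.sum_le_sum_of_subset_of_nonneg ?_ fun _ _ _ => hnn _ _
      exact Finset.filter_subset_filter _ (Finset.subset_insert _ _)
    have k2 : ∑ a ∈ S, ∑ b ∈ S.filter (fun b => ¬ Disjoint (F a) (F b)),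
        q a * q b * p ^ (F a ∪ F b).card ≤
        ∑ a ∈ S, ∑ b ∈ (insert i S).filter (fun b => ¬ Disjoint (F a) (F b)),
        q a * q b * p ^ (F a ∪ F b).card := by
      refine Finset.sum_le_sum fun a _ => ?_
      refine Finset.sum_le_sum_of_subset_of_nonneg ?_ fun _ _ _ => hnn _ _
      exact Finset.filter_subset_filter _ (Finset.subset_insert _ _)
    have k3 : q i * c = q i * p ^ (F i).card - ∑ a ∈ near, q i * q a * p ^ (F i ∪ F a).card := by
      rw [hc, mul_sub, Finset.mul_sum]
      congr 1
      exact Finset.sum_congr rfl fun _ _ => by ring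
    linarith

open Classical in
/-- Probability of an event. -/
noncomputable def Pr (p : ℝ) (A : Set (E → Bool)) : ℝ := Ex p (fun ω => if ω ∈ A then 1 else 0)

lemma Pr_mono {p : ℝ} (h0 : 0 ≤ p) (h1 : p ≤ 1) {A B : Set (E → Bool)} (h : A ⊆ B) :
    Pr p A ≤ Pr p B := by
  refine Ex_mono h0 h1 fun ω => ?_
  by_cases h2 : ω ∈ A
  · simp [h2, h h2]
  · simp only [h2, if_false]; split_ifs <;> norm_num

lemma Pr_nonneg {p : ℝ} (h0 : 0 ≤ p) (h1 : p ≤ 1) (A : Set (E → Bool)) : 0 ≤ Pr p A :=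
  Ex_nonneg h0 h1 fun ω => by split_ifs <;> norm_num

lemma Pr_union_le {p : ℝ} (h0 : 0 ≤ p) (h1 : p ≤ 1) (A B : Set (E → Bool)) :
    Pr p (A ∪ B) ≤ Pr p A + Pr p B := by
  unfold Pr Ex
  rw [← Finset.sum_add_distrib]
  refine Finset.sum_le_sum fun ω _ => ?_
  rw [← mul_add]
  refine mul_le_mul_of_nonneg_left ?_ (Wt_nonneg h0 h1 ω)
  by_cases h2 : ω ∈ A <;> by_cases h3 : ω ∈ B <;> simp [h2, h3]

/-- Union bound over a finite type. -/
lemma Pr_iUnion_le {κ : Type*} [Fintype κ] {p : ℝ} (h0 : 0 ≤ p) (h1 : p ≤ 1)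
    (A : κ → Set (E → Bool)) (c : ℝ) (h : ∀ a, Pr p (A a) ≤ c) :
    Pr p (⋃ a, A a) ≤ Fintype.card κ * c := by
  classical
  have : Pr p (⋃ a, A a) ≤ ∑ a, Pr p (A a) := by
    unfold Pr
    rw [← Ex_sum]
    refine Ex_mono h0 h1 fun ω => ?_
    have hnn : ∀ a ∈ Finset.univ, (0 : ℝ) ≤ (if ω ∈ A a then 1 else 0) := fun a _ => by
      split_ifs <;> norm_num
    split_ifs with h2
    · obtain ⟨a, ha⟩ := Set.mem_iUnion.1 h2
      refine le_trans ?_ (Finset.single_le_sum hnn (Finset.mem_univ a))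
      simp [ha]
    · exact Finset.sum_nonneg hnn
  refine this.trans ((Finset.sum_le_sum fun a _ => h a).trans ?_)
  simp

/-- The probability of avoiding a family is at most the expectation of the thinned product. -/
lemma Pr_avoid_le {κ : Type*} {p : ℝ} (h0 : 0 ≤ p) (h1 : p ≤ 1)
    (F : κ → Finset E) (q : κ → ℝ) (hq0 : ∀ a, 0 ≤ q a) (hq1 : ∀ a, q a ≤ 1) (S : Finset κ) :
    Pr p {ω | ∀ a ∈ S, ¬ ∀ e ∈ F a, ω e = true} ≤ Ex p (Dp F q S) := by
  refine Ex_mono h0 h1 fun ω => ?_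
  split_ifs with h
  · refine le_of_eq (Eq.symm (Finset.prod_eq_one fun a ha => ?_))
    have : ind (F a) ω = 0 := if_neg (h a ha)
    rw [this]; ring
  · exact Finset.prod_nonneg fun a _ => fac_nonneg (hq0 a) (hq1 a) _ _

end Prob

end PartA

section PartB

open MeasureTheory Filter Topology

set_option linter.unusedSectionVars false

/-! ### Tasks and the probability that no task can be realised -/

open Classical in
/-- Number of edges of `J` inside `I`. -/
noncomputable def eIn {V : Type*} [Fintype V] (J : SimpleGraph V) (I : Finset V) : ℕ :=
  (J.edgeFinset.filter (fun e => ∀ v ∈ e, v ∈ I)).card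

/-- The density conditions on a task. -/
def GoodTask {V : Type*} (d : ℕ) {g : ℕ} (J : SimpleGraph (Fin g)) (A : Fin g → Finset V) : Prop :=
  ∀ I : Finset (Fin g), (∑ i ∈ I, (A i).card) + eIn J I ≤ d * I.card ∧ eIn J I ≤ d * (I.card - 1)

/-- `x` realises the task `(J, A)` in `G`. -/
def Realizes {V : Type*} (G : SimpleGraph V) {g : ℕ} (J : SimpleGraph (Fin g))
    (A : Fin g → Finset V) (x : Fin g → V) : Prop :=
  Function.Injective x ∧ (∀ i i', J.Adj i i' → G.Adj (x i) (x i')) ∧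
    ∀ i, ∀ a ∈ A i, G.Adj a (x i)

section counting

variable {g u : ℕ}

lemma count_aux (lam : ℝ) (hl : 0 ≤ lam) (x : Fin g → Fin u) (T : Finset (Fin g)) :
    ∑ x' : Fin g → Fin u, (if ∀ i ∈ T, x i = x' i then
      lam ^ (Finset.univ.filter (fun i => x i = x' i)).card else 0)
      ≤ lam ^ T.card * (u + lam) ^ (g - T.card) := by
  have h1 : ∀ x' : Fin g → Fin u, (if ∀ i ∈ T, x i = x' i then
      lam ^ (Finset.univ.filter (fun i => x i = x' i)).card else 0) =
      ∏ i, (if x i = x' i then lam else if i ∈ T then 0 else 1) := by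
    intro x'
    split_ifs with h
    · rw [← Finset.prod_const, Finset.prod_filter]
      refine Finset.prod_congr rfl fun i _ => ?_
      by_cases h2 : x i = x' i
      · simp [h2]
      · have : i ∉ T := fun hi => h2 (h i hi)
        simp [h2, this]
    · push Not at h
      obtain ⟨i, hi, hne⟩ := h
      refine (Finset.prod_eq_zero (Finset.mem_univ i) ?_).symm
      simp [hne, hi]
  simp_rw [h1]
  rw [← Fintype.prod_sum (fun i (y : Fin u) => (if x i = y then lam else if i ∈ T then (0:ℝ) else 1))]
  have h2 : ∀ i, ∑ y : Fin u, (if x i = y then lam else if i ∈ T then (0:ℝ) else 1) ≤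
      if i ∈ T then lam else u + lam := by
    intro i
    split_ifs with hi
    · simp
    · have : ∀ y : Fin u, (if x i = y then lam else (1:ℝ)) ≤ 1 + (if x i = y then lam else 0) := by
        intro y; split_ifs <;> linarith
      refine (Finset.sum_le_sum fun y _ => this y).trans ?_
      rw [Finset.sum_add_distrib]
      simp
  refine (Finset.prod_le_prod (fun i _ => Finset.sum_nonneg fun y _ => ?_) fun i _ => h2 i).trans ?_
  · split_ifs <;> first | exact hl | norm_num
  · rw [Finset.prod_ite]
    simp only [Finset.prod_const]
    have e1 : (Finset.univ.filter (fun i => i ∈ T)) = T := by simp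
    have e2 : (Finset.univ.filter (fun i => i ∉ T)).card = g - T.card := by
      rw [Finset.filter_not, e1, ← Finset.compl_eq_univ_sdiff, Finset.card_compl]; simp
    rw [e1, e2]

lemma pow_aux (lam : ℝ) (hl : 0 ≤ lam) (hu : 0 < u) (hg : 0 < g) (hL : g * lam ≤ u) (s : ℕ)
    (hs : s ≤ g) : (u + lam) ^ (g - s) ≤ 3 * ((u:ℝ) ^ g / u ^ s) := by
  have hu' : (0:ℝ) < u := by exact_mod_cast hu
  have hg' : (0:ℝ) < g := by exact_mod_cast hg
  have h1 : (u:ℝ) + lam = u * (1 + lam / u) := by field_simp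
  have h2 : (1 + lam / u) ^ (g - s) ≤ 3 := by
    have h3 : (1 + lam / u) ^ (g - s) ≤ (1 + lam / u) ^ g :=
      pow_le_pow_right₀ (by have := div_nonneg hl hu'.le; linarith) (Nat.sub_le _ _)
    have h4 : 1 + lam / u ≤ Real.exp (1 / g) := by
      refine le_trans ?_ (Real.add_one_le_exp _)
      have : lam / u ≤ 1 / g := by
        rw [div_le_div_iff₀ hu' hg']; linarith
      linarith
    have h5 : (1 + lam / u) ^ g ≤ Real.exp 1 := by
      refine (pow_le_pow_left₀ (by have := div_nonneg hl hu'.le; linarith) h4 g).trans ?_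
      rw [← Real.exp_nat_mul]
      apply le_of_eq; congr 1; field_simp
    have := Real.exp_one_lt_d9
    linarith
  rw [h1, mul_pow]
  have h6 : (u:ℝ) ^ (g - s) = u ^ g / u ^ s := by
    rw [pow_sub₀ _ hu'.ne' hs]; rfl
  rw [h6]
  have : (0:ℝ) ≤ u ^ g / u ^ s := by positivity
  nlinarith

lemma count_one (lam : ℝ) (hl : 0 ≤ lam) (hu : 0 < u) (hg : 0 < g) (hL : g * lam ≤ u)
    (x : Fin g → Fin u) :
    ∑ x' : Fin g → Fin u, (if 1 ≤ (Finset.univ.filter (fun i => x i = x' i)).card then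
      lam ^ (Finset.univ.filter (fun i => x i = x' i)).card else 0)
      ≤ 3 * g * (lam / u) * (u:ℝ) ^ g := by
  have h1 : ∀ x' : Fin g → Fin u, (if 1 ≤ (Finset.univ.filter (fun i => x i = x' i)).card then
      lam ^ (Finset.univ.filter (fun i => x i = x' i)).card else 0) ≤
      ∑ i : Fin g, (if ∀ i' ∈ ({i} : Finset (Fin g)), x i' = x' i' then
      lam ^ (Finset.univ.filter (fun i => x i = x' i)).card else 0) := by
    intro x'
    have hnn : ∀ i ∈ (Finset.univ : Finset (Fin g)),
      0 ≤ (if ∀ i' ∈ ({i} : Finset (Fin g)), x i' = x' i' then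
      lam ^ (Finset.univ.filter (fun i => x i = x' i)).card else 0) := by
      intro i _; split_ifs <;> positivity
    split_ifs with h
    · obtain ⟨i, hi⟩ := Finset.card_pos.1 h
      refine le_trans ?_ (Finset.single_le_sum hnn (Finset.mem_univ i))
      rw [if_pos]
      simpa using hi
    · exact Finset.sum_nonneg hnn
  refine (Finset.sum_le_sum fun x' _ => h1 x').trans ?_
  rw [Finset.sum_comm]
  refine (Finset.sum_le_sum fun i _ => count_aux lam hl x {i}).trans ?_
  simp only [Finset.card_singleton, pow_one, Finset.sum_const, Finset.card_univ, Fintype.card_fin,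
    nsmul_eq_mul]
  have := mul_le_mul_of_nonneg_left (pow_aux lam hl hu hg hL 1 hg) (mul_nonneg (Nat.cast_nonneg (α := ℝ) g) hl)
  calc _ = (g:ℝ) * lam * (u + lam) ^ (g - 1) := by ring
    _ ≤ _ := this
    _ = _ := by rw [pow_one]; ring

lemma count_two (lam : ℝ) (hl : 0 < lam) (hu : 0 < u) (hg : 0 < g) (hL : g * lam ≤ u)
    (x : Fin g → Fin u) :
    ∑ x' : Fin g → Fin u, (if 2 ≤ (Finset.univ.filter (fun i => x i = x' i)).card then
      lam ^ ((Finset.univ.filter (fun i => x i = x' i)).card - 1) else 0)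
      ≤ 3 * g ^ 2 * (lam / u ^ 2) * (u:ℝ) ^ g := by
  classical
  set P := (Finset.univ : Finset (Fin g)).offDiag with hP
  have h1 : ∀ x' : Fin g → Fin u, (if 2 ≤ (Finset.univ.filter (fun i => x i = x' i)).card then
      lam ^ ((Finset.univ.filter (fun i => x i = x' i)).card - 1) else 0) ≤
      ∑ i ∈ P, lam⁻¹ * (if ∀ i' ∈ ({i.1, i.2} : Finset (Fin g)), x i' = x' i' then
      lam ^ (Finset.univ.filter (fun i => x i = x' i)).card else 0) := by
    intro x'
    have hnn : ∀ i ∈ P,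
      0 ≤ lam⁻¹ * (if ∀ i' ∈ ({i.1, i.2} : Finset (Fin g)), x i' = x' i' then
      lam ^ (Finset.univ.filter (fun i => x i = x' i)).card else 0) := by
      intro i _; split_ifs <;> positivity
    split_ifs with h
    · obtain ⟨i, hi, i', hi', hne⟩ := Finset.one_lt_card.1 h
      refine le_trans ?_ (Finset.single_le_sum hnn (a := (i, i')) (by simp [hP, hne]))
      rw [if_pos]
      · apply le_of_eq
        obtain ⟨c, hc⟩ : ∃ c, (Finset.univ.filter (fun i => x i = x' i)).card = c + 1 :=
          ⟨_, (Nat.sub_add_cancel (by omega)).symm⟩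
        rw [hc, pow_succ]; field_simp; simp
      · simp at hi hi' ⊢; exact ⟨hi, hi'⟩
    · exact Finset.sum_nonneg hnn
  refine (Finset.sum_le_sum fun x' _ => h1 x').trans ?_
  rw [Finset.sum_comm]
  have h2 : ∀ i ∈ P, ∑ x' : Fin g → Fin u, lam⁻¹ *
      (if ∀ i' ∈ ({i.1, i.2} : Finset (Fin g)), x i' = x' i' then
      lam ^ (Finset.univ.filter (fun i => x i = x' i)).card else 0) ≤
      lam * (3 * ((u:ℝ) ^ g / u ^ 2)) := by
    intro i hi
    have hne : i.1 ≠ i.2 := by simpa [hP] using hi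
    have hc : ({i.1, i.2} : Finset (Fin g)).card = 2 := Finset.card_pair hne
    have hg2 : 2 ≤ g := by
      have := Finset.card_le_univ ({i.1, i.2} : Finset (Fin g))
      simpa [hc] using this
    rw [← Finset.mul_sum]
    refine (mul_le_mul_of_nonneg_left (count_aux lam hl.le x _) (inv_nonneg.2 hl.le)).trans ?_
    rw [hc]
    have := pow_aux lam hl.le hu hg hL 2 hg2
    calc _ = lam * (u + lam) ^ (g - 2) := by field_simp
      _ ≤ _ := mul_le_mul_of_nonneg_left this hl.le
  refine (Finset.sum_le_sum h2).trans ?_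
  rw [Finset.sum_const, nsmul_eq_mul]
  have h3 : (P.card : ℝ) ≤ (g:ℝ) ^ 2 := by
    rw [hP, Finset.offDiag_card]
    simp only [Finset.card_univ, Fintype.card_fin]
    have : g * g - g ≤ g ^ 2 := by rw [sq]; omega
    exact_mod_cast this
  have h4 : 0 ≤ lam * (3 * ((u:ℝ) ^ g / u ^ 2)) := by positivity
  calc _ ≤ (g:ℝ) ^ 2 * (lam * (3 * ((u:ℝ) ^ g / u ^ 2))) := mul_le_mul_of_nonneg_right h3 h4
    _ = _ := by ring

end counting

end PartB

section PartC

open MeasureTheory Filter Topology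

set_option linter.unusedSectionVars false

section tasks

variable {n g k u d : ℕ}

open Classical in
/-- Edges required by task `(J, A)` placed at the vertices `v`. -/
noncomputable def reqE (J : SimpleGraph (Fin g)) (A : Fin g → Finset (Fin n)) (v : Fin g → Fin n) :
    Finset (Sym2 (Fin n)) :=
  (Finset.univ.biUnion fun i => (A i).image fun a => s(a, v i)) ∪
    J.edgeFinset.image (Sym2.map v)

lemma realizes_of_reqE (J : SimpleGraph (Fin g)) (A : Fin g → Finset (Fin n)) (v : Fin g → Fin n)
    (hv : Function.Injective v) (hA : ∀ i, ∀ a ∈ A i, ∀ i', a ≠ v i') (ω : Sym2 (Fin n) → Bool)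
    (h : ∀ e ∈ reqE J A v, ω e = true) : Realizes (graphOf ω) J A v := by
  classical
  refine ⟨hv, fun i i' hi => ?_, fun i a ha => ?_⟩
  · rw [graphOf, SimpleGraph.fromRel_adj]
    refine ⟨fun h2 => hi.ne (hv h2), Or.inl (h _ ?_)⟩
    rw [reqE, Finset.mem_union]
    right
    rw [Finset.mem_image]
    exact ⟨s(i, i'), by simpa using hi, rfl⟩
  · rw [graphOf, SimpleGraph.fromRel_adj]
    refine ⟨hA i a ha i, Or.inl (h _ ?_)⟩
    rw [reqE, Finset.mem_union]
    left
    rw [Finset.mem_biUnion]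
    exact ⟨i, Finset.mem_univ _, Finset.mem_image.2 ⟨a, ha, rfl⟩⟩

open Classical in
lemma inter_cases (J J' : SimpleGraph (Fin g)) (A A' : Fin g → Finset (Fin n))
    (pos : Fin g → Fin u → Fin n)
    (hpos : ∀ i y i' y', pos i y = pos i' y' → i = i' ∧ y = y')
    (hA : ∀ i, ∀ a ∈ A i, ∀ i' y, a ≠ pos i' y) (hA' : ∀ i, ∀ a ∈ A' i, ∀ i' y, a ≠ pos i' y)
    (x x' : Fin g → Fin u) (e : Sym2 (Fin n))
    (he : e ∈ reqE J A (fun i => pos i (x i))) (he' : e ∈ reqE J' A' (fun i => pos i (x' i))) :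
    (∃ i, x i = x' i ∧ ∃ a ∈ A i, a ∈ A' i ∧ e = s(a, pos i (x i))) ∨
    (∃ e0 ∈ J.edgeFinset.filter (fun e => ∀ v ∈ e, v ∈ Finset.univ.filter (fun i => x i = x' i)),
      e = Sym2.map (fun i => pos i (x i)) e0) := by
  rw [reqE, Finset.mem_union, Finset.mem_biUnion, Finset.mem_image] at he he'
  rcases he with ⟨i, -, hi⟩ | ⟨e0, he0, rfl⟩
  · obtain ⟨a, ha, rfl⟩ := Finset.mem_image.1 hi
    left
    rcases he' with ⟨i', -, hi'⟩ | ⟨e1, he1, h⟩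
    · obtain ⟨a', ha', h⟩ := Finset.mem_image.1 hi'
      rcases Sym2.eq_iff.1 h with ⟨h1, h2⟩ | ⟨h1, h2⟩
      · obtain ⟨rfl, h3⟩ := hpos _ _ _ _ h2
        subst h1
        exact ⟨_, h3.symm, _, ha, ha', rfl⟩
      · exact absurd h1 (hA' _ _ ha' _ _)
    · exfalso
      induction e1 using Sym2.ind with
      | _ b c =>
      simp only [Sym2.map_mk] at h
      rcases Sym2.eq_iff.1 h with ⟨h1, h2⟩ | ⟨h1, h2⟩
      · exact hA _ _ ha _ _ h1.symm
      · exact hA _ _ ha _ _ h2.symm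
  · right
    refine ⟨e0, ?_, rfl⟩
    rw [Finset.mem_filter]
    refine ⟨he0, ?_⟩
    induction e0 using Sym2.ind with
    | _ b c =>
    rcases he' with ⟨i', -, hi'⟩ | ⟨e1, he1, h⟩
    · exfalso
      obtain ⟨a', ha', h⟩ := Finset.mem_image.1 hi'
      simp only [Sym2.map_mk] at h
      rcases Sym2.eq_iff.1 h with ⟨h1, h2⟩ | ⟨h1, h2⟩
      · exact hA' _ _ ha' _ _ h1
      · exact hA' _ _ ha' _ _ h1
    · induction e1 using Sym2.ind with
      | _ b' c' =>
      simp only [Sym2.map_mk] at h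
      have hbc : x' b = x b ∧ x' c = x c := by
        rcases Sym2.eq_iff.1 h with ⟨h1, h2⟩ | ⟨h1, h2⟩
        · obtain ⟨rfl, h3⟩ := hpos _ _ _ _ h1
          obtain ⟨rfl, h4⟩ := hpos _ _ _ _ h2
          exact ⟨h3, h4⟩
        · obtain ⟨rfl, h3⟩ := hpos _ _ _ _ h1
          obtain ⟨rfl, h4⟩ := hpos _ _ _ _ h2
          exact ⟨h4, h3⟩
      intro v hv
      rw [Finset.mem_filter]
      refine ⟨Finset.mem_univ _, ?_⟩
      rcases Sym2.mem_iff.1 hv with rfl | rfl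
      exacts [hbc.1.symm, hbc.2.symm]

lemma inter_card_same (J : SimpleGraph (Fin g)) (A : Fin g → Finset (Fin n))
    (hgood : GoodTask d J A) (pos : Fin g → Fin u → Fin n)
    (hpos : ∀ i y i' y', pos i y = pos i' y' → i = i' ∧ y = y')
    (hA : ∀ i, ∀ a ∈ A i, ∀ i' y, a ≠ pos i' y)
    (x x' : Fin g → Fin u) :
    (reqE J A (fun i => pos i (x i)) ∩ reqE J A (fun i => pos i (x' i))).card ≤
      d * (Finset.univ.filter (fun i => x i = x' i)).card := by
  classical
  refine le_trans ?_ (hgood (Finset.univ.filter (fun i => x i = x' i))).1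
  have hsub : reqE J A (fun i => pos i (x i)) ∩ reqE J A (fun i => pos i (x' i)) ⊆
      ((Finset.univ.filter (fun i => x i = x' i)).biUnion fun i =>
        (A i).image fun a => s(a, pos i (x i))) ∪
      (J.edgeFinset.filter (fun e => ∀ v ∈ e, v ∈ Finset.univ.filter (fun i => x i = x' i))).image
        (Sym2.map (fun i => pos i (x i))) := by
    intro e he
    rw [Finset.mem_inter] at he
    rcases inter_cases J J A A pos hpos hA hA x x' e he.1 he.2 with ⟨i, hi, a, ha, _, rfl⟩ |
      ⟨e0, he0, rfl⟩
    · refine Finset.mem_union_left _ (Finset.mem_biUnion.2 ⟨i, by simpa using hi, ?_⟩)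
      exact Finset.mem_image.2 ⟨a, ha, rfl⟩
    · exact Finset.mem_union_right _ (Finset.mem_image.2 ⟨e0, he0, rfl⟩)
  refine (Finset.card_le_card hsub).trans ((Finset.card_union_le _ _).trans ?_)
  refine add_le_add ?_ ?_
  · exact Finset.card_biUnion_le.trans (Finset.sum_le_sum fun i _ => Finset.card_image_le)
  · unfold eIn
    refine Finset.card_image_le.trans (le_of_eq ?_)
    congr!

lemma inter_card_diff (J J' : SimpleGraph (Fin g)) (A A' : Fin g → Finset (Fin n))
    (hgood : GoodTask d J A) (pos : Fin g → Fin u → Fin n)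
    (hpos : ∀ i y i' y', pos i y = pos i' y' → i = i' ∧ y = y')
    (hA : ∀ i, ∀ a ∈ A i, ∀ i' y, a ≠ pos i' y) (hA' : ∀ i, ∀ a ∈ A' i, ∀ i' y, a ≠ pos i' y)
    (hdis : ∀ i i', Disjoint (A i) (A' i'))
    (x x' : Fin g → Fin u) :
    (reqE J A (fun i => pos i (x i)) ∩ reqE J' A' (fun i => pos i (x' i))).card ≤
      d * ((Finset.univ.filter (fun i => x i = x' i)).card - 1) := by
  classical
  refine le_trans ?_ (hgood (Finset.univ.filter (fun i => x i = x' i))).2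
  have hsub : reqE J A (fun i => pos i (x i)) ∩ reqE J' A' (fun i => pos i (x' i)) ⊆
      (J.edgeFinset.filter (fun e => ∀ v ∈ e, v ∈ Finset.univ.filter (fun i => x i = x' i))).image
        (Sym2.map (fun i => pos i (x i))) := by
    intro e he
    rw [Finset.mem_inter] at he
    rcases inter_cases J J' A A' pos hpos hA hA' x x' e he.1 he.2 with ⟨i, hi, a, ha, ha', rfl⟩ |
      ⟨e0, he0, rfl⟩
    · exact absurd ha' (Finset.disjoint_left.1 (hdis i i) ha)
    · exact (Finset.mem_image.2 ⟨e0, he0, rfl⟩)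
  refine (Finset.card_le_card hsub).trans ?_
  unfold eIn
  refine Finset.card_image_le.trans (le_of_eq ?_)
  congr!

theorem tasks_prob {p : ℝ} (h0 : 0 < p) (h1 : p ≤ 1) (hg : 0 < g) (hk : k ≤ u) (hu : 0 < u)
    (hL : (g : ℝ) ≤ u * p ^ d)
    (J : Fin k → SimpleGraph (Fin g)) (A : Fin k → Fin g → Finset (Fin n))
    (hgood : ∀ j, GoodTask d (J j) (A j))
    (hdis : ∀ j j', j ≠ j' → ∀ i i', Disjoint (A j i) (A j' i'))
    (pos : Fin g → Fin u → Fin n)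
    (hpos : ∀ i y i' y', pos i y = pos i' y' → i = i' ∧ y = y')
    (hA : ∀ j i, ∀ a ∈ A j i, ∀ i' y, a ≠ pos i' y) :
    Pr p {ω | ∀ j (x : Fin g → Fin u),
      ¬ Realizes (graphOf ω) (J j) (A j) (fun i => pos i (x i))} ≤
      Real.exp (-(k * (u * p ^ d / (24 * g ^ 2)))) := by
  classical
  set L : ℝ := u * p ^ d with hLdef
  have hg' : (1:ℝ) ≤ g := by exact_mod_cast hg
  have hu' : (0:ℝ) < u := by exact_mod_cast hu
  have hpd : 0 < p ^ d := pow_pos h0 d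
  have hL0 : 0 < L := by positivity
  have hL1 : 1 ≤ L := hg'.trans hL
  set lam : ℝ := (p ^ d)⁻¹ with hlam
  have hlam0 : 0 < lam := inv_pos.2 hpd
  have hlamL : lam / u = 1 / L := by rw [hlam, hLdef]; field_simp
  have hgl : g * lam ≤ u := by
    rw [hlam, ← div_eq_mul_inv, div_le_iff₀ hpd]; exact hL
  set t : ℝ := L / (12 * g ^ 2) with ht
  have ht0 : 0 < t := by positivity
  have htL : t ≤ L := by
    rw [ht, div_le_iff₀ (by positivity)]
    have : (1:ℝ) ≤ 12 * g ^ 2 := by nlinarith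
    nlinarith
  let F : Fin k × (Fin g → Fin u) → Finset (Sym2 (Fin n)) := fun a =>
    reqE (J a.1) (A a.1) (fun i => pos i (a.2 i))
  let q : Fin k × (Fin g → Fin u) → ℝ := fun a => t / (u ^ g * p ^ (F a).card)
  have hFcard : ∀ a, (F a).card ≤ d * g := by
    intro a
    have := inter_card_same (J a.1) (A a.1) (hgood _) pos hpos (hA _) a.2 a.2
    rw [Finset.inter_self] at this
    simpa using this
  have hden : ∀ a, 0 < (u:ℝ) ^ g * p ^ (F a).card := fun a => by positivity
  have hq0 : ∀ a, 0 ≤ q a := fun a => div_nonneg ht0.le (hden a).le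
  have hq1 : ∀ a, q a ≤ 1 := by
    intro a
    rw [div_le_one (hden a)]
    refine htL.trans ?_
    have e1 : p ^ (d * g) ≤ p ^ (F a).card := pow_le_pow_of_le_one h0.le h1 (hFcard a)
    have e2 : L ^ g = u ^ g * p ^ (d * g) := by rw [hLdef, mul_pow, pow_mul]
    have e3 : L ≤ L ^ g := le_self_pow₀ hL1 hg.ne'
    calc L ≤ L ^ g := e3
      _ = u ^ g * p ^ (d * g) := e2
      _ ≤ _ := by gcongr
  have hsub : {ω | ∀ j (x : Fin g → Fin u),
      ¬ Realizes (graphOf ω) (J j) (A j) (fun i => pos i (x i))} ⊆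
      {ω | ∀ a ∈ (Finset.univ : Finset (Fin k × (Fin g → Fin u))), ¬ ∀ e ∈ F a, ω e = true} := by
    intro ω hω a _ h
    refine hω a.1 a.2 (realizes_of_reqE _ _ _ ?_ ?_ _ h)
    · intro i i' hi
      exact (hpos _ _ _ _ hi).1
    · intro i b hb i'
      exact hA _ _ _ hb _ _
  refine (Pr_mono h0.le h1 hsub).trans ((Pr_avoid_le h0.le h1 F q hq0 hq1 _).trans
    ((janson h0.le h1 F q hq0 hq1 _).trans ?_))
  apply Real.exp_le_exp.2
  have hug : (0:ℝ) < (u:ℝ) ^ g := by positivity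
  have hcardx : Fintype.card (Fin g → Fin u) = u ^ g := by simp
  -- first sum
  have hS1 : ∑ a, q a * p ^ (F a).card = k * t := by
    have : ∀ a, q a * p ^ (F a).card = t / u ^ g := fun a => by
      have : p ^ (F a).card ≠ 0 := by positivity
      simp only [q]; field_simp
    simp_rw [this]
    rw [Finset.sum_const, Finset.card_univ, Fintype.card_prod, hcardx, nsmul_eq_mul]
    push_cast
    simp only [Fintype.card_fin]
    field_simp
  -- second sum
  have hpair : ∀ a b, q a * q b * p ^ (F a ∪ F b).card =
      t ^ 2 / (u ^ g) ^ 2 * (p ^ (F a ∩ F b).card)⁻¹ := by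
    intro a b
    have e : (F a ∪ F b).card + (F a ∩ F b).card = (F a).card + (F b).card :=
      Finset.card_union_add_card_inter _ _
    have e' : p ^ (F a ∪ F b).card * p ^ (F a ∩ F b).card = p ^ (F a).card * p ^ (F b).card := by
      rw [← pow_add, e, pow_add]
    have n1 : p ^ (F a).card ≠ 0 := by positivity
    have n2 : p ^ (F b).card ≠ 0 := by positivity
    have n3 : p ^ (F a ∩ F b).card ≠ 0 := by positivity
    simp only [q]
    field_simp
    linear_combination e'
  have hinv : ∀ c c' : ℕ, c ≤ d * c' → (p ^ c)⁻¹ ≤ lam ^ c' := by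
    intro c c' hc
    rw [hlam, inv_pow, ← pow_mul]
    exact inv_anti₀ (by positivity) (pow_le_pow_of_le_one h0.le h1 hc)
  have hrow : ∀ a, ∑ b ∈ Finset.univ.filter (fun b => ¬ Disjoint (F a) (F b)),
      q a * q b * p ^ (F a ∪ F b).card ≤ t ^ 2 / (u ^ g) ^ 2 * (6 * g ^ 2 / L * u ^ g) := by
    rintro ⟨j, x⟩
    simp_rw [hpair]
    rw [← Finset.mul_sum]
    refine mul_le_mul_of_nonneg_left ?_ (by positivity)
    have hterm : ∀ b : Fin k × (Fin g → Fin u),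
        (if ¬ Disjoint (F (j, x)) (F b) then (p ^ (F (j, x) ∩ F b).card)⁻¹ else 0) ≤
        (if j = b.1 then
          (if 1 ≤ (Finset.univ.filter (fun i => x i = b.2 i)).card then
            lam ^ (Finset.univ.filter (fun i => x i = b.2 i)).card else 0) else 0) +
        (if 2 ≤ (Finset.univ.filter (fun i => x i = b.2 i)).card then
            lam ^ ((Finset.univ.filter (fun i => x i = b.2 i)).card - 1) else 0) := by
      rintro ⟨j', x'⟩
      set c := (Finset.univ.filter (fun i => x i = x' i)).card with hc
      have p1 : 0 ≤ (if j = j' then (if 1 ≤ c then lam ^ c else 0) else 0) := by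
        split_ifs <;> positivity
      have p2 : 0 ≤ (if 2 ≤ c then lam ^ (c - 1) else 0) := by
        split_ifs <;> positivity
      by_cases hd : Disjoint (F (j, x)) (F (j', x'))
      · simp only [hd, not_true, if_false]
        exact add_nonneg p1 p2
      · rw [if_pos hd]
        have hne : 0 < (F (j, x) ∩ F (j', x')).card := by
          rw [Finset.card_pos, Finset.nonempty_iff_ne_empty]
          exact fun h => hd (Finset.disjoint_iff_inter_eq_empty.2 h)
        by_cases hj : j = j'
        · subst hj
          have hh := inter_card_same (J j) (A j) (hgood _) pos hpos (hA _) x x'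
          have hc1 : 1 ≤ c := by
            by_contra h
            have : c = 0 := by omega
            rw [← hc, this] at hh
            change (F (j, x) ∩ F (j, x')).card ≤ _ at hh
            omega
          refine le_add_of_le_of_nonneg ?_ p2
          rw [if_pos rfl, if_pos hc1]
          exact hinv _ _ hh
        · have hh := inter_card_diff (J j) (J j') (A j) (A j') (hgood _) pos hpos (hA _) (hA _)
            (hdis j j' hj) x x'
          have hc1 : 2 ≤ c := by
            by_contra h
            have : c - 1 = 0 := by omega
            rw [← hc, this] at hh
            change (F (j, x) ∩ F (j', x')).card ≤ _ at hh
            omega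
          refine le_add_of_nonneg_of_le p1 ?_
          rw [if_pos hc1]
          exact hinv _ _ hh
    rw [Finset.sum_filter]
    refine (Finset.sum_le_sum fun b _ => hterm b).trans ?_
    rw [Finset.sum_add_distrib, Fintype.sum_prod_type, Fintype.sum_prod_type]
    have c1 := count_one lam hlam0.le hu hg hgl x
    have c2 := count_two lam hlam0 hu hg hgl x
    have s1 : ∑ j' : Fin k, ∑ x' : Fin g → Fin u, (if j = j' then
          (if 1 ≤ (Finset.univ.filter (fun i => x i = x' i)).card then
            lam ^ (Finset.univ.filter (fun i => x i = x' i)).card else 0) else 0) =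
        ∑ x' : Fin g → Fin u, (if 1 ≤ (Finset.univ.filter (fun i => x i = x' i)).card then
            lam ^ (Finset.univ.filter (fun i => x i = x' i)).card else 0) := by
      rw [Finset.sum_comm]
      refine Finset.sum_congr rfl fun x' _ => ?_
      simp
    simp only
    rw [s1, Finset.sum_const, Finset.card_univ, Fintype.card_fin, nsmul_eq_mul]
    have hkr : (k:ℝ) ≤ u := by exact_mod_cast hk
    have f1 : 3 * g * (lam / u) * (u:ℝ) ^ g ≤ 3 * g ^ 2 / L * u ^ g := by
      rw [hlamL]
      have : (g:ℝ) ≤ g ^ 2 := by nlinarith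
      calc 3 * (g:ℝ) * (1 / L) * u ^ g = 3 * g / L * u ^ g := by ring
        _ ≤ _ := by gcongr
    have f2 : (k:ℝ) * (3 * g ^ 2 * (lam / u ^ 2) * (u:ℝ) ^ g) ≤ 3 * g ^ 2 / L * u ^ g := by
      calc _ ≤ (u:ℝ) * (3 * g ^ 2 * (lam / u ^ 2) * (u:ℝ) ^ g) := by gcongr
        _ = 3 * g ^ 2 * (lam / u) * (u:ℝ) ^ g := by field_simp
        _ = _ := by rw [hlamL]; ring
    have f3 : (k:ℝ) * ∑ x' : Fin g → Fin u,
        (if 2 ≤ (Finset.univ.filter (fun i => x i = x' i)).card then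
      lam ^ ((Finset.univ.filter (fun i => x i = x' i)).card - 1) else 0) ≤
      (k:ℝ) * (3 * g ^ 2 * (lam / u ^ 2) * (u:ℝ) ^ g) := by gcongr
    calc _ ≤ 3 * g * (lam / u) * (u:ℝ) ^ g + (k:ℝ) * (3 * g ^ 2 * (lam / u ^ 2) * (u:ℝ) ^ g) :=
          add_le_add c1 f3
      _ ≤ 3 * g ^ 2 / L * u ^ g + 3 * g ^ 2 / L * u ^ g := add_le_add f1 f2
      _ = _ := by ring
  rw [hS1]
  have hS2 : ∑ a, ∑ b ∈ Finset.univ.filter (fun b => ¬ Disjoint (F a) (F b)),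
      q a * q b * p ^ (F a ∪ F b).card ≤ k * (t ^ 2 * (6 * g ^ 2 / L)) := by
    refine (Finset.sum_le_sum fun a _ => hrow a).trans ?_
    rw [Finset.sum_const, Finset.card_univ, Fintype.card_prod, hcardx, nsmul_eq_mul]
    push_cast
    simp only [Fintype.card_fin]
    apply le_of_eq
    field_simp
  have hfin : t ^ 2 * (6 * g ^ 2 / L) = t / 2 := by
    rw [ht]; field_simp; norm_num
  have hfin2 : L / (24 * g ^ 2) = t / 2 := by rw [ht]; field_simp; norm_num
  rw [hfin] at hS2
  rw [hfin2]
  linarith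

end tasks

end PartC

section PartD

open MeasureTheory Filter Topology

set_option linter.unusedSectionVars false

section pseudorandom

/-- The pseudorandomness property used for embedding. -/
def PR {n : ℕ} (G : SimpleGraph (Fin n)) (d gmax K N : ℕ) (R : Fin N → Finset (Fin n)) : Prop :=
  ∀ g, 1 ≤ g → g ≤ gmax → ∀ k, 1 ≤ k → k ≤ K →
    ∀ (J : Fin k → SimpleGraph (Fin g)) (A : Fin k → Fin g → Finset (Fin n)),
    (∀ j, GoodTask d (J j) (A j)) → (∀ j j', j ≠ j' → ∀ i i', Disjoint (A j i) (A j' i')) →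
    ∀ U : Finset (Fin n), (∀ j i, Disjoint (A j i) U) → gmax * K ≤ U.card →
    (k = K ∨ ∃ i, ∃ Q : Finset (Fin n), Q.card ≤ g * k ∧ U = R i \ Q) →
    ∃ j x, Realizes G (J j) (A j) x ∧ ∀ i, x i ∈ U

open Classical in
/-- Decoding a finset from a function. -/
noncomputable def decS {V : Type*} [Fintype V] {d : ℕ} (f : Fin d → Option V) : Finset V :=
  Finset.univ.filter (fun v => ∃ l, f l = some v)

lemma decS_surj {V : Type*} [Fintype V] {d : ℕ} (S : Finset V) (h : S.card ≤ d) :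
    ∃ f : Fin d → Option V, decS f = S := by
  classical
  refine ⟨fun l => if hl : l.1 < S.card then some (S.equivFin.symm ⟨l.1, hl⟩).1 else none, ?_⟩
  ext v
  simp only [decS, Finset.mem_filter, Finset.mem_univ, true_and]
  constructor
  · rintro ⟨l, hl⟩
    split_ifs at hl with h1
    simp only [Option.some.injEq] at hl
    rw [← hl]
    exact (S.equivFin.symm ⟨l.1, h1⟩).2
  · intro hv
    have hlt := (S.equivFin ⟨v, hv⟩).2
    refine ⟨⟨(S.equivFin ⟨v, hv⟩).1, hlt.trans_le h⟩, ?_⟩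
    simp

/-- A fixed family of tasks and fixed host set fail. -/
def badEv {n g k : ℕ} (d gmax K : ℕ) (J : Fin k → SimpleGraph (Fin g))
    (A : Fin k → Fin g → Finset (Fin n))
    (U : Finset (Fin n)) : Set (Sym2 (Fin n) → Bool) :=
  {ω | (∀ j, GoodTask d (J j) (A j)) ∧ (∀ j j', j ≠ j' → ∀ i i', Disjoint (A j i) (A j' i')) ∧
    (∀ j i, Disjoint (A j i) U) ∧ gmax * K ≤ U.card ∧
    ∀ j x, ¬ (Realizes (graphOf ω) (J j) (A j) x ∧ ∀ i, x i ∈ U)}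

lemma badEv_prob {n g k d gmax K : ℕ} {p : ℝ} (h0 : 0 < p) (h1 : p ≤ 1) (hg : 1 ≤ g)
    (hgm : g ≤ gmax) (hK : 0 < K) (hk : k ≤ K) (hL : (gmax : ℝ) ≤ K * p ^ d)
    (J : Fin k → SimpleGraph (Fin g))
    (A : Fin k → Fin g → Finset (Fin n)) (U : Finset (Fin n)) :
    Pr p (badEv d gmax K J A U) ≤ Real.exp (-(K * p ^ d / (24 * gmax ^ 2))) ^ k := by
  by_cases hyp : (∀ j, GoodTask d (J j) (A j)) ∧
      (∀ j j', j ≠ j' → ∀ i i', Disjoint (A j i) (A j' i')) ∧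
      (∀ j i, Disjoint (A j i) U) ∧ gmax * K ≤ U.card
  · obtain ⟨hgood, hdis, hAU, hU⟩ := hyp
    have hcard : Fintype.card (Fin g × Fin K) ≤ Fintype.card U := by
      simp only [Fintype.card_prod, Fintype.card_fin, Fintype.card_coe]
      exact (Nat.mul_le_mul_right K hgm).trans hU
    obtain ⟨emb⟩ := Function.Embedding.nonempty_of_card_le hcard
    have hgr : (g:ℝ) ≤ gmax := by exact_mod_cast hgm
    have hg1 : (1:ℝ) ≤ g := by exact_mod_cast hg
    have := tasks_prob (u := K) (d := d) h0 h1 hg hk hK (hgr.trans hL) J A hgood hdis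
      (fun i y => (emb (i, y)).1) (fun i y i' y' h => by
        have := emb.injective (Subtype.ext h)
        simpa using this)
      (fun j i a ha i' y h => Finset.disjoint_left.1 (hAU j i) ha (h ▸ (emb (i', y)).2))
    refine (Pr_mono h0.le h1 ?_).trans (this.trans ?_)
    · intro ω hω j x hr
      exact hω.2.2.2.2 j _ ⟨hr, fun i => (emb (i, x i)).2⟩
    · rw [← Real.exp_nat_mul]
      apply Real.exp_le_exp.2
      rw [mul_neg, neg_le_neg_iff]
      gcongr
  · have : badEv (n := n) d gmax K J A U ⊆ ∅ := by
      intro ω hω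
      exact hyp ⟨hω.1, hω.2.1, hω.2.2.1, hω.2.2.2.1⟩
    refine (Pr_mono h0.le h1 this).trans ?_
    have e : Pr (E := Sym2 (Fin n)) p ∅ = 0 := by simp [Pr, Ex]
    rw [e]
    positivity

/-- Codes for tasks. -/
abbrev TCode (n d g : ℕ) : Type := (Fin g → Fin g → Bool) × (Fin g → Fin d → Option (Fin n))

/-- decode the graph -/
def decJ {n d g : ℕ} (c : TCode n d g) : SimpleGraph (Fin g) :=
  SimpleGraph.fromRel fun a b => c.1 a b = true

/-- decode the sets -/
noncomputable def decA {n d g : ℕ} (c : TCode n d g) (i : Fin g) : Finset (Fin n) := decS (c.2 i)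

lemma code_surj {n d g : ℕ} (J : SimpleGraph (Fin g)) (A : Fin g → Finset (Fin n))
    (h : GoodTask d J A) : ∃ c : TCode n d g, decJ c = J ∧ decA c = A := by
  classical
  have : ∀ i, (A i).card ≤ d := fun i => by
    have := (h {i}).1
    simp only [Finset.sum_singleton, Finset.card_singleton, mul_one] at this
    omega
  choose f hf using fun i => decS_surj (A i) (this i)
  refine ⟨(fun a b => decide (J.Adj a b), f), ?_, ?_⟩
  · ext a b
    simp only [decJ, SimpleGraph.fromRel_adj, decide_eq_true_eq]
    constructor
    · rintro ⟨-, h | h⟩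
      exacts [h, h.symm]
    · intro h; exact ⟨h.ne, Or.inl h⟩
  · funext i; exact hf i

lemma card_TCode (n d g : ℕ) : Fintype.card (TCode n d g) = 2 ^ (g * g) * (n + 1) ^ (d * g) := by
  simp [TCode, pow_mul]

lemma notPR_prob {n d gmax K N : ℕ} {p : ℝ} (h0 : 0 < p) (h1 : p ≤ 1)
    (hK : 0 < K) (hL : (gmax : ℝ) ≤ K * p ^ d) (R : Fin N → Finset (Fin n))
    (M δ : ℝ) (hMdef : M = 2 ^ (gmax * gmax) * ((n:ℝ) + 1) ^ ((d + 1) * gmax) *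
      Real.exp (-(K * p ^ d / (24 * gmax ^ 2)))) (hM : M ≤ 1)
    (hδ1 : ((gmax:ℝ) + 1) * (K + 1) * N * M ≤ δ) (hδ2 : ((gmax:ℝ) + 1) * 2 ^ n * M ^ K ≤ δ) :
    Pr p {ω | ¬ PR (graphOf ω) d gmax K N R} ≤ 2 * δ := by
  classical
  set b := Real.exp (-(K * p ^ d / (24 * gmax ^ 2))) with hb
  have hb0 : 0 < b := Real.exp_pos _
  have hM0 : 0 < M := by rw [hMdef]; positivity
  have hn1 : (1:ℝ) ≤ (n:ℝ) + 1 := by have := Nat.cast_nonneg (α := ℝ) n; linarith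
  let S1 : Fin (gmax + 1) × Fin (K + 1) → Set (Sym2 (Fin n) → Bool) := fun gk =>
    if 1 ≤ gk.1.1 ∧ 1 ≤ gk.2.1 then
      ⋃ c : (Fin gk.2.1 → TCode n d gk.1.1) × Fin N × (Fin (gk.1.1 * gk.2.1) → Option (Fin n)),
        badEv d gmax K (fun j => decJ (c.1 j)) (fun j => decA (c.1 j)) (R c.2.1 \ decS c.2.2)
    else ∅
  let S2 : Fin (gmax + 1) → Set (Sym2 (Fin n) → Bool) := fun g =>
    if 1 ≤ g.1 then
      ⋃ c : (Fin K → TCode n d g.1) × Finset (Fin n),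
        badEv d gmax K (fun j => decJ (c.1 j)) (fun j => decA (c.1 j)) c.2
    else ∅
  have hsub : {ω | ¬ PR (graphOf ω) d gmax K N R} ⊆ (⋃ gk, S1 gk) ∪ (⋃ g, S2 g) := by
    intro ω hω
    simp only [Set.mem_setOf_eq, PR] at hω
    push Not at hω
    obtain ⟨g, hg1, hgm, k, hk1, hkK, J, A, hgood, hdis, U, hAU, hU, hor, hbad⟩ := hω
    choose c hcJ hcA using fun j => code_surj (J j) (A j) (hgood j)
    have hcJ' : (fun j => decJ (c j)) = J := funext hcJ
    have hcA' : (fun j => decA (c j)) = A := funext hcA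
    have hmem : ω ∈ badEv d gmax K J A U := by
      refine ⟨hgood, hdis, hAU, hU, fun j x hx => ?_⟩
      obtain ⟨i, hi⟩ := hbad j x hx.1
      exact hi (hx.2 i)
    rcases hor with rfl | ⟨i, Q, hQ, rfl⟩
    · right
      refine Set.mem_iUnion.2 ⟨⟨g, by omega⟩, ?_⟩
      simp only [S2]
      rw [if_pos hg1]
      refine Set.mem_iUnion.2 ⟨(c, U), ?_⟩
      simp only [hcJ', hcA']
      exact hmem
    · left
      obtain ⟨f, hf⟩ := decS_surj Q hQ
      refine Set.mem_iUnion.2 ⟨(⟨g, by omega⟩, ⟨k, by omega⟩), ?_⟩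
      simp only [S1]
      rw [if_pos ⟨hg1, hk1⟩]
      refine Set.mem_iUnion.2 ⟨(c, i, f), ?_⟩
      simp only [hcJ', hcA', hf]
      exact hmem
  have hcode : ∀ g, g ≤ gmax → ((Fintype.card (TCode n d g) : ℕ) : ℝ) * (n + 1) ^ g * b ≤ M := by
    intro g hg
    rw [card_TCode, hMdef]
    push_cast
    refine mul_le_mul_of_nonneg_right ?_ hb0.le
    rw [mul_assoc, ← pow_add]
    have : d * g + g ≤ (d + 1) * gmax := by nlinarith
    gcongr
    · norm_num
  have hcode2 : ∀ g, g ≤ gmax → ((Fintype.card (TCode n d g) : ℕ) : ℝ) * b ≤ M := by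
    intro g hg
    refine le_trans ?_ (hcode g hg)
    have h3 : (1:ℝ) ≤ ((n:ℝ) + 1) ^ g := one_le_pow₀ hn1
    have h4 : (0:ℝ) ≤ (Fintype.card (TCode n d g) : ℕ) := Nat.cast_nonneg _
    refine mul_le_mul_of_nonneg_right ?_ hb0.le
    nlinarith
  have hP0 : Pr (E := Sym2 (Fin n)) p ∅ = 0 := by simp [Pr, Ex]
  have hS1 : ∀ gk, Pr p (S1 gk) ≤ N * M := by
    rintro ⟨⟨g, hg⟩, ⟨k, hk⟩⟩
    simp only [S1]
    split_ifs with h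
    · refine (Pr_iUnion_le h0.le h1 _ (b ^ k) fun c =>
        badEv_prob h0 h1 h.1 (by omega) hK (by omega) hL _ _ _).trans ?_
      simp only [Fintype.card_prod, Fintype.card_fun, Fintype.card_fin, Fintype.card_option]
      have e1 := hcode g (by omega)
      have e2 : (((Fintype.card (TCode n d g) : ℕ) : ℝ) * (n + 1) ^ g * b) ^ k ≤ M := by
        refine (pow_le_pow_left₀ (by positivity) e1 k).trans ?_
        exact pow_le_of_le_one hM0.le hM (by omega)
      simp only [TCode, Fintype.card_prod, Fintype.card_fun, Fintype.card_fin,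
        Fintype.card_option] at e2
      push_cast at e2 ⊢
      calc _ = (N:ℝ) * (((2:ℝ) ^ g) ^ g * ((((n:ℝ) + 1) ^ d) ^ g) * (n + 1) ^ g * b) ^ k := by
            simp only [Fintype.card_bool, Nat.cast_ofNat]
            rw [pow_mul, mul_pow, mul_pow]; ring
        _ ≤ N * M := by
            refine mul_le_mul_of_nonneg_left ?_ (Nat.cast_nonneg _)
            simpa using e2
    · rw [hP0]; positivity
  have hS2 : ∀ g, Pr p (S2 g) ≤ 2 ^ n * M ^ K := by
    rintro ⟨g, hg⟩
    simp only [S2]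
    split_ifs with h
    · refine (Pr_iUnion_le h0.le h1 _ (b ^ K) fun c =>
        badEv_prob h0 h1 h (by omega) hK le_rfl hL _ _ _).trans ?_
      rw [Fintype.card_prod, Fintype.card_fun, Fintype.card_fin, Fintype.card_finset,
        Fintype.card_fin]
      have e1 := hcode2 g (by omega)
      have e2 := pow_le_pow_left₀ (by positivity) e1 K
      push_cast
      calc _ = (2:ℝ) ^ n * (((Fintype.card (TCode n d g) : ℕ) : ℝ) * b) ^ K := by
            rw [mul_pow]; ring
        _ ≤ _ := by gcongr
    · rw [hP0]; positivity
  refine (Pr_mono h0.le h1 hsub).trans ((Pr_union_le h0.le h1 _ _).trans ?_)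
  have f1 := Pr_iUnion_le h0.le h1 S1 _ hS1
  have f2 := Pr_iUnion_le h0.le h1 S2 _ hS2
  simp only [Fintype.card_prod, Fintype.card_fin] at f1 f2
  push_cast at f1 f2
  have g1 : ((gmax:ℝ) + 1) * (K + 1) * (N * M) = ((gmax:ℝ) + 1) * (K + 1) * N * M := by ring
  have g2 : ((gmax:ℝ) + 1) * (2 ^ n * M ^ K) = ((gmax:ℝ) + 1) * 2 ^ n * M ^ K := by ring
  linarith

end pseudorandom

end PartD

section PartE

open MeasureTheory Filter Topology

set_option linter.unusedSectionVars false

/-! ### Deterministic embedding of one stage -/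

/-- A joint realisation of all tasks in `s`, inside `C`. -/
def Full {V ι : Type*} (G : SimpleGraph V) {g : ℕ} (J : ι → SimpleGraph (Fin g))
    (A : ι → Fin g → Finset V) (s : Finset ι) (C : Finset V) (X : ι → Fin g → V) : Prop :=
  (∀ j ∈ s, Realizes G (J j) (A j) (X j)) ∧
    (∀ j ∈ s, ∀ j' ∈ s, j ≠ j' → ∀ i i', X j i ≠ X j' i') ∧ ∀ j ∈ s, ∀ i, X j i ∈ C

section stage

variable {V ι : Type*} [DecidableEq V] [DecidableEq ι] {G : SimpleGraph V} {g : ℕ}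
  {J : ι → SimpleGraph (Fin g)} {A : ι → Fin g → Finset V}

lemma Full.union {s₁ s₂ : Finset ι} {C₁ C₂ : Finset V} {X₁ X₂ : ι → Fin g → V}
    (h₁ : Full G J A s₁ C₁ X₁) (h₂ : Full G J A s₂ C₂ X₂) (hC : Disjoint C₁ C₂) :
    ∃ X, Full G J A (s₁ ∪ s₂) (C₁ ∪ C₂) X := by
  refine ⟨fun j => if j ∈ s₁ then X₁ j else X₂ j, ?_, ?_, ?_⟩
  · intro j hj
    by_cases h : j ∈ s₁
    · simpa [h] using h₁.1 j h
    · have : j ∈ s₂ := by simpa [h] using hj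
      simpa [h] using h₂.1 j this
  · intro j hj j' hj' hne i i'
    rw [Finset.disjoint_left] at hC
    by_cases h : j ∈ s₁ <;> by_cases h' : j' ∈ s₁
    · simpa [h, h'] using h₁.2.1 j h j' h' hne i i'
    · have h2 : j' ∈ s₂ := by simpa [h'] using hj'
      simp only [h, h', if_true, if_false]
      intro he
      exact hC (h₁.2.2 j h i) (he ▸ h₂.2.2 j' h2 i')
    · have h2 : j ∈ s₂ := by simpa [h] using hj
      simp only [h, h', if_true, if_false]
      intro he
      exact hC (h₁.2.2 j' h' i') (he ▸ h₂.2.2 j h2 i)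
    · have h2 : j ∈ s₂ := by simpa [h] using hj
      have h3 : j' ∈ s₂ := by simpa [h'] using hj'
      simpa [h, h'] using h₂.2.1 j h2 j' h3 hne i i'
  · intro j hj i
    by_cases h : j ∈ s₁
    · simp only [h, if_true]
      exact Finset.mem_union_left _ (h₁.2.2 j h i)
    · have h2 : j ∈ s₂ := by simpa [h] using hj
      simp only [h, if_false]
      exact Finset.mem_union_right _ (h₂.2.2 j h2 i)

lemma greedy (s : Finset ι) (B : Finset V) (P : Finset ι → Prop) (X0 : ι → Fin g → V)
    (h : ∀ s₁ ⊆ s, P (s \ s₁) → ∀ Q : Finset V, Q.card ≤ g * s₁.card →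
      ∃ j ∈ s \ s₁, ∃ x, Realizes G (J j) (A j) x ∧ ∀ i, x i ∈ B \ Q) :
    ∃ s₁ ⊆ s, ¬ P (s \ s₁) ∧ ∃ X, Full G J A s₁ B X := by
  by_contra hcon
  push Not at hcon
  have key : ∀ k, k ≤ s.card + 1 → ∃ s₁ ⊆ s, s₁.card = k ∧ ∃ X, Full G J A s₁ B X := by
    intro k
    induction k with
    | zero =>
      intro _
      exact ⟨∅, by simp, by simp, X0, by simp [Full]⟩
    | succ k ih =>
      intro hk
      obtain ⟨s₁, hs, hc, X, hX⟩ := ih (by omega)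
      have hPs : P (s \ s₁) := by
        by_contra hn
        exact hcon s₁ hs hn X hX
      obtain ⟨j, hj, x, hx, hxB⟩ := h s₁ hs hPs (s₁.biUnion fun j => Finset.univ.image (X j)) (by
        refine Finset.card_biUnion_le.trans ?_
        refine (Finset.sum_le_card_nsmul _ _ g fun j _ => ?_).trans (by simp [mul_comm])
        exact Finset.card_image_le.trans (by simp))
      simp only [Finset.mem_sdiff] at hj
      have hxB1 : ∀ i, x i ∈ B := fun i => (Finset.mem_sdiff.1 (hxB i)).1
      have hxB2 : ∀ i, ∀ j' ∈ s₁, ∀ i', X j' i' ≠ x i := by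
        intro i j' hj' i' he
        refine (Finset.mem_sdiff.1 (hxB i)).2 ?_
        refine Finset.mem_biUnion.2 ⟨j', hj', Finset.mem_image.2 ⟨i', Finset.mem_univ _, he⟩⟩
      have hne : ∀ j' ∈ s₁, j' ≠ j := fun j' h1 h2 => hj.2 (h2 ▸ h1)
      refine ⟨insert j s₁, ?_, ?_, Function.update X j x, ?_, ?_, ?_⟩
      · exact Finset.insert_subset hj.1 hs
      · rw [Finset.card_insert_of_notMem hj.2, hc]
      · intro j' hj'
        rcases Finset.mem_insert.1 hj' with rfl | h1
        · simpa using hx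
        · simpa [hne j' h1] using hX.1 j' h1
      · intro a ha b hb hab i i'
        rcases Finset.mem_insert.1 ha with rfl | h1 <;> rcases Finset.mem_insert.1 hb with rfl | h2
        · exact absurd rfl hab
        · simpa [hne b h2] using (hxB2 i b h2 i').symm
        · simpa [hne a h1] using (hxB2 i' a h1 i)
        · simpa [hne a h1, hne b h2] using hX.2.1 a h1 b h2 hab i i'
      · intro j' hj' i
        rcases Finset.mem_insert.1 hj' with rfl | h1
        · simpa using hxB1 i
        · simpa [hne j' h1] using hX.2.2 j' h1 i
  obtain ⟨s₁, hs, hc, -⟩ := key (s.card + 1) le_rfl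
  have := Finset.card_le_card hs
  omega

end stage

lemma PR.fin {n : ℕ} {G : SimpleGraph (Fin n)} {d gmax K N : ℕ} {R : Fin N → Finset (Fin n)}
    (h : PR G d gmax K N R) {g : ℕ} (hg : 1 ≤ g) (hg' : g ≤ gmax) {ι : Type*}
    {J : ι → SimpleGraph (Fin g)} {A : ι → Fin g → Finset (Fin n)}
    (hgood : ∀ j, GoodTask d (J j) (A j))
    (hdis : ∀ j j', j ≠ j' → ∀ i i', Disjoint (A j i) (A j' i'))
    (s : Finset ι) (hs : 1 ≤ s.card) (hs' : s.card ≤ K) (U : Finset (Fin n))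
    (hU : ∀ j i, Disjoint (A j i) U) (hUc : gmax * K ≤ U.card)
    (hor : s.card = K ∨ ∃ i, ∃ Q : Finset (Fin n), Q.card ≤ g * s.card ∧ U = R i \ Q) :
    ∃ j ∈ s, ∃ x, Realizes G (J j) (A j) x ∧ ∀ i, x i ∈ U := by
  let e := s.equivFin
  obtain ⟨j, x, hx⟩ := h g hg hg' s.card hs hs' (fun k => J (e.symm k)) (fun k => A (e.symm k))
    (fun k => hgood _) (fun k k' hk => hdis _ _ (fun he => hk (e.symm.injective (Subtype.ext he))))
    U (fun k i => hU _ i) hUc hor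
  exact ⟨_, (e.symm j).2, x, hx⟩

lemma stage_reserve {n : ℕ} {G : SimpleGraph (Fin n)} {d gmax K N : ℕ}
    {R : Fin N → Finset (Fin n)}
    (h : PR G d gmax K N R) {g : ℕ} (hg : 1 ≤ g) (hg' : g ≤ gmax) {ι : Type*} [DecidableEq ι]
    {J : ι → SimpleGraph (Fin g)} {A : ι → Fin g → Finset (Fin n)}
    (hgood : ∀ j, GoodTask d (J j) (A j))
    (hdis : ∀ j j', j ≠ j' → ∀ i i', Disjoint (A j i) (A j' i'))
    (X0 : ι → Fin g → Fin n)
    (r : ℕ → Fin N) (hRc : ∀ a, (R (r a)).card = 2 * (gmax * K))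
    (ℓ : ℕ) (hRA : ∀ a < ℓ, ∀ j i, Disjoint (A j i) (R (r a)))
    (hRR : ∀ a < ℓ, ∀ b < ℓ, a ≠ b → Disjoint (R (r a)) (R (r b)))
    (s : Finset ι) (hs' : s.card ≤ K) :
    ∀ t ≤ ℓ, ∃ s₁ ⊆ s, (s \ s₁).card * 2 ^ t ≤ s.card ∧
      ∃ X, Full G J A s₁ ((Finset.range t).biUnion fun a => R (r a)) X := by
  intro t
  induction t with
  | zero => exact fun _ => ⟨∅, by simp, by simp, X0, by simp [Full]⟩
  | succ t ih =>
    intro ht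
    obtain ⟨s₁, hs₁, hc, X, hX⟩ := ih (by omega)
    obtain ⟨s₂, hs₂, hP, Y, hY⟩ := greedy (G := G) (J := J) (A := A) (s \ s₁) (R (r t))
      (fun q => (s \ s₁).card < 2 * q.card) X0 (by
        intro s₂ hs₂ hlt Q hQ
        have e1 : ((s \ s₁) \ s₂).card = (s \ s₁).card - s₂.card :=
          Finset.card_sdiff_of_subset hs₂
        have e2 := Finset.card_le_card hs₂
        have e3 : (s \ s₁).card ≤ K := (Finset.card_le_card Finset.sdiff_subset).trans hs'
        have hQ2 : Q.card ≤ g * ((s \ s₁) \ s₂).card := by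
          refine hQ.trans (Nat.mul_le_mul_left _ ?_)
          omega
        refine h.fin hg hg' hgood hdis _ (by omega) (by omega) (R (r t) \ Q) ?_ ?_
          (Or.inr ⟨_, Q, hQ2, rfl⟩)
        · intro j i
          exact Finset.disjoint_of_subset_right Finset.sdiff_subset (hRA t (by omega) j i)
        · have e4 := Finset.le_card_sdiff Q (R (r t))
          rw [hRc] at e4
          have : Q.card ≤ gmax * K := hQ.trans (Nat.mul_le_mul hg' (by omega))
          omega)
    have hdisj : Disjoint ((Finset.range t).biUnion fun a => R (r a)) (R (r t)) := by
      rw [Finset.disjoint_biUnion_left]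
      intro a ha
      have := Finset.mem_range.1 ha
      exact hRR a (by omega) t (by omega) (by omega)
    obtain ⟨Z, hZ⟩ := hX.union hY hdisj
    refine ⟨s₁ ∪ s₂, Finset.union_subset hs₁ (hs₂.trans Finset.sdiff_subset), ?_, Z, ?_⟩
    · have e : s \ (s₁ ∪ s₂) = (s \ s₁) \ s₂ := by
        ext j
        simp only [Finset.mem_sdiff, Finset.mem_union]
        tauto
      rw [e, pow_succ]
      have hP' : 2 * ((s \ s₁) \ s₂).card ≤ (s \ s₁).card := by omega
      calc _ = 2 * ((s \ s₁) \ s₂).card * 2 ^ t := by ring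
        _ ≤ (s \ s₁).card * 2 ^ t := Nat.mul_le_mul_right _ hP'
        _ ≤ _ := hc
    · rw [Finset.range_add_one, Finset.biUnion_insert, Finset.union_comm (R (r t))]
      exact hZ

lemma stage {n : ℕ} {G : SimpleGraph (Fin n)} {d gmax K N : ℕ}
    {R : Fin N → Finset (Fin n)}
    (h : PR G d gmax K N R) (hK : 1 ≤ K) {g : ℕ} (hg : 1 ≤ g) (hg' : g ≤ gmax) {ι : Type*}
    [Fintype ι] [DecidableEq ι]
    {J : ι → SimpleGraph (Fin g)} {A : ι → Fin g → Finset (Fin n)}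
    (hgood : ∀ j, GoodTask d (J j) (A j))
    (hdis : ∀ j j', j ≠ j' → ∀ i i', Disjoint (A j i) (A j' i'))
    (F : Finset (Fin n)) (hF : ∀ j i, Disjoint (A j i) F)
    (hFc : gmax * K + g * Fintype.card ι ≤ F.card)
    (r : ℕ → Fin N) (hRc : ∀ a, (R (r a)).card = 2 * (gmax * K))
    (ℓ : ℕ) (hℓ : K < 2 ^ ℓ) (hRA : ∀ a < ℓ, ∀ j i, Disjoint (A j i) (R (r a)))
    (hRR : ∀ a < ℓ, ∀ b < ℓ, a ≠ b → Disjoint (R (r a)) (R (r b)))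
    (hRF : ∀ a < ℓ, Disjoint F (R (r a))) :
    ∃ X, Full G J A Finset.univ (F ∪ (Finset.range ℓ).biUnion fun a => R (r a)) X := by
  have hFpos : 0 < F.card := by
    have : 1 ≤ gmax * K := Nat.mul_pos (by omega) hK
    omega
  obtain ⟨f0, hf0⟩ := Finset.card_pos.1 hFpos
  obtain ⟨s₁, hs₁, hP, X, hX⟩ := greedy (G := G) (J := J) (A := A) Finset.univ F
      (fun q => K ≤ q.card) (fun _ _ => f0) (by
        intro s₂ hs₂ hlt Q hQ
        obtain ⟨s₃, hs₃, hc⟩ := Finset.exists_subset_card_eq hlt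
        obtain ⟨j, hj, x⟩ := h.fin hg hg' hgood hdis s₃ (by omega) (by omega) (F \ Q) (fun j i =>
          Finset.disjoint_of_subset_right Finset.sdiff_subset (hF j i)) (by
          have e4 := Finset.le_card_sdiff Q F
          have : Q.card ≤ g * Fintype.card ι :=
            hQ.trans (Nat.mul_le_mul_left _ (Finset.card_le_univ _))
          omega) (Or.inl hc)
        exact ⟨j, hs₃ hj, x⟩)
  obtain ⟨s₂, hs₂, hc, Y, hY⟩ := stage_reserve h hg hg' hgood hdis (fun _ _ => f0) r hRc ℓ hRA hRR
    (Finset.univ \ s₁) (by omega) ℓ le_rfl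
  have hz : (Finset.univ \ s₁) \ s₂ = ∅ := by
    rw [← Finset.card_eq_zero]
    by_contra hne
    have : 1 * 2 ^ ℓ ≤ ((Finset.univ \ s₁) \ s₂).card * 2 ^ ℓ := Nat.mul_le_mul_right _ (by omega)
    omega
  obtain ⟨Z, hZ⟩ := hX.union hY (by
    rw [Finset.disjoint_biUnion_right]
    intro a ha
    exact hRF a (Finset.mem_range.1 ha))
  refine ⟨Z, ?_⟩
  have : s₁ ∪ s₂ = Finset.univ := by
    ext j
    have := Finset.ext_iff.1 hz j
    simp only [Finset.mem_sdiff, Finset.mem_univ, true_and, Finset.notMem_empty, iff_false] at this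
    simp only [Finset.mem_union, Finset.mem_univ, iff_true]
    tauto
  rwa [this] at hZ

end PartE

section PartE2

open MeasureTheory Filter Topology

set_option linter.unusedSectionVars false

/-! ### Extending a partial embedding by one step -/

/-- Distinct vertices at distance at least three. -/
def Far {W : Type*} (H : SimpleGraph W) (x y : W) : Prop :=
  x ≠ y ∧ ¬ H.Adj x y ∧ ∀ z, ¬ (H.Adj x z ∧ H.Adj y z)

open Classical in
/-- `E'` is obtained from `E` by adding far apart pieces of the same size, each of which is
sparse. -/
def StepOK {W : Type*} [Fintype W] (H : SimpleGraph W) (d gmax : ℕ) (E E' : Finset W) : Prop :=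
  ∃ g, 1 ≤ g ∧ g ≤ gmax ∧ ∃ P : Finset (Finset W),
    (∀ S ∈ P, S.card = g ∧ Disjoint S E ∧ ∀ I ⊆ S,
      (∑ x ∈ I, (E.filter (H.Adj x)).card) + eIn H I ≤ d * I.card ∧ eIn H I ≤ d * (I.card - 1)) ∧
    (∀ S ∈ P, ∀ S' ∈ P, S ≠ S' → ∀ x ∈ S, ∀ y ∈ S', Far H x y) ∧ E' = E ∪ P.biUnion id

open Classical in
lemma eIn_comap_le {W : Type*} [Fintype W] (H : SimpleGraph W) {g : ℕ} (y : Fin g → W)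
    (hy : Function.Injective y) (I : Finset (Fin g)) :
    eIn (H.comap y) I ≤ eIn H (I.image y) := by
  unfold eIn
  refine Finset.card_le_card_of_injOn (Sym2.map y) ?_ ((Sym2.map.injective hy).injOn)
  intro e he
  simp only [Finset.coe_filter, SimpleGraph.mem_edgeFinset, Set.mem_ofPred_eq] at he ⊢
  induction e with | _ a b
  simp only [SimpleGraph.mem_edgeSet, SimpleGraph.comap_adj, Sym2.mem_iff, forall_eq_or_imp,
    forall_eq, Sym2.map_mk, Finset.mem_image] at he ⊢
  exact ⟨he.1, ⟨a, he.2.1, rfl⟩, ⟨b, he.2.2, rfl⟩⟩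

lemma extend_step {n : ℕ} {G : SimpleGraph (Fin n)} {d gmax K N : ℕ}
    {R : Fin N → Finset (Fin n)} (h : PR G d gmax K N R) (hK : 1 ≤ K)
    {W : Type*} [Fintype W] {H : SimpleGraph W} {E E' : Finset W} (hst : StepOK H d gmax E E')
    (φ : W → Fin n) (hinj : Set.InjOn φ E) (hhom : ∀ u ∈ E, ∀ v ∈ E, H.Adj u v → G.Adj (φ u) (φ v))
    (F : Finset (Fin n)) (hF : ∀ u ∈ E, φ u ∉ F)
    (hFc : gmax * K + Fintype.card W ≤ F.card + E.card)
    (r : ℕ → Fin N) (hRc : ∀ a, (R (r a)).card = 2 * (gmax * K))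
    (ℓ : ℕ) (hℓ : K < 2 ^ ℓ) (hRA : ∀ a < ℓ, ∀ u ∈ E, φ u ∉ R (r a))
    (hRR : ∀ a < ℓ, ∀ b < ℓ, a ≠ b → Disjoint (R (r a)) (R (r b)))
    (hRF : ∀ a < ℓ, Disjoint F (R (r a))) :
    ∃ φ' : W → Fin n, Set.InjOn φ' E' ∧ (∀ u ∈ E', ∀ v ∈ E', H.Adj u v → G.Adj (φ' u) (φ' v)) ∧
      ∀ u ∈ E', (u ∈ E ∧ φ' u = φ u) ∨ φ' u ∈ F ∨ ∃ a < ℓ, φ' u ∈ R (r a) := by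
  classical
  obtain ⟨g, hg, hg', P, hP, hfar, rfl⟩ := hst
  let ι := {S // S ∈ P}
  have hex : ∀ S : ι, ∃ y : Fin g → W, Function.Injective y ∧ ∀ w, w ∈ S.1 ↔ ∃ i, y i = w := by
    intro S
    have e := S.1.equivFinOfCardEq (hP S.1 S.2).1
    refine ⟨fun i => (e.symm i).1, fun i i' hi => e.symm.injective (Subtype.ext hi), ?_⟩
    intro w
    constructor
    · intro hw
      exact ⟨e ⟨w, hw⟩, by simp⟩
    · rintro ⟨i, rfl⟩
      exact (e.symm i).2
  choose y hyi hyr using hex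
  have hyS : ∀ S i, y S i ∈ S.1 := fun S i => (hyr S _).2 ⟨i, rfl⟩
  have hyE : ∀ S i, y S i ∉ E := fun S i hE =>
    Finset.disjoint_left.1 (hP S.1 S.2).2.1 (hyS S i) hE
  have hfar' : ∀ S S' : ι, S ≠ S' → ∀ i i', Far H (y S i) (y S' i') := fun S S' hne i i' =>
    hfar S.1 S.2 S'.1 S'.2 (fun he => hne (Subtype.ext he)) _ (hyS S i) _ (hyS S' i')
  have hyu : ∀ S S' i i', y S i = y S' i' → S = S' := by
    intro S S' i i' he
    by_contra hne
    exact (hfar' S S' hne i i').1 he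
  let J : ι → SimpleGraph (Fin g) := fun S => H.comap (y S)
  let A : ι → Fin g → Finset (Fin n) := fun S i => (E.filter (H.Adj (y S i))).image φ
  have hAmem : ∀ S i b, b ∈ A S i → ∃ a ∈ E, H.Adj (y S i) a ∧ φ a = b := by
    intro S i b hb
    obtain ⟨a, ha, rfl⟩ := Finset.mem_image.1 hb
    rw [Finset.mem_filter] at ha
    exact ⟨a, ha.1, ha.2, rfl⟩
  have hgood : ∀ S, GoodTask d (J S) (A S) := by
    intro S I
    have hsub : I.image (y S) ⊆ S.1 := by
      intro w hw
      obtain ⟨i, -, rfl⟩ := Finset.mem_image.1 hw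
      exact hyS S i
    have hc : (I.image (y S)).card = I.card := Finset.card_image_of_injective _ (hyi S)
    obtain ⟨h1, h2⟩ := (hP S.1 S.2).2.2 _ hsub
    have h3 := eIn_comap_le H (y S) (hyi S) I
    rw [hc] at h1 h2
    rw [Finset.sum_image (fun a _ b _ hab => hyi S hab)] at h1
    have h4 : ∑ i ∈ I, (A S i).card ≤ ∑ x ∈ I, (E.filter (H.Adj (y S x))).card :=
      Finset.sum_le_sum fun i _ => Finset.card_image_le
    exact ⟨by simp only [J]; omega, by simp only [J]; omega⟩
  have hdis : ∀ S S', S ≠ S' → ∀ i i', Disjoint (A S i) (A S' i') := by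
    intro S S' hne i i'
    rw [Finset.disjoint_left]
    intro b hb hb'
    obtain ⟨a, ha, hadj, rfl⟩ := hAmem S i b hb
    obtain ⟨a', ha', hadj', he⟩ := hAmem S' i' _ hb'
    have := hinj ha' ha he
    subst this
    exact (hfar' S S' hne i i').2.2 _ ⟨hadj, hadj'⟩
  have hcard : g * Fintype.card ι + E.card ≤ Fintype.card W := by
    have h1 : (P.biUnion id).card = g * Fintype.card ι := by
      rw [Finset.card_biUnion]
      · simp only [id]
        rw [Finset.sum_congr rfl (fun S hS => (hP S hS).1)]
        simp [ι, mul_comm]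
      · intro S hS S' hS' hne
        rw [Function.onFun, Finset.disjoint_left]
        intro x hx hx'
        exact (hfar S hS S' hS' hne x hx x hx').1 rfl
    have h2 : Disjoint (P.biUnion id) E := by
      rw [Finset.disjoint_biUnion_left]
      exact fun S hS => (hP S hS).2.1
    rw [← h1, ← Finset.card_union_of_disjoint h2]
    exact Finset.card_le_univ _
  obtain ⟨X, hX1, hX2, hX3⟩ := stage h hK hg hg' hgood hdis F (by
      intro S i
      rw [Finset.disjoint_left]
      intro b hb
      obtain ⟨a, ha, -, rfl⟩ := hAmem S i b hb
      exact hF a ha) (by omega) r hRc ℓ hℓ (by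
      intro t ht S i
      rw [Finset.disjoint_left]
      intro b hb
      obtain ⟨a, ha, -, rfl⟩ := hAmem S i b hb
      exact hRA t ht a ha) hRR hRF
  let φ' : W → Fin n := fun w => if hw : ∃ q : ι × Fin g, y q.1 q.2 = w then
    X hw.choose.1 hw.choose.2 else φ w
  have hφ1 : ∀ u ∈ E, φ' u = φ u := by
    intro u hu
    simp only [φ']
    rw [dif_neg]
    rintro ⟨q, rfl⟩
    exact hyE _ _ hu
  have hφ2 : ∀ S i, φ' (y S i) = X S i := by
    intro S i
    have hw : ∃ q : ι × Fin g, y q.1 q.2 = y S i := ⟨(S, i), rfl⟩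
    simp only [φ']
    rw [dif_pos hw]
    have h1 := hw.choose_spec
    have h2 := hyu _ _ _ _ h1
    generalize hw.choose = q at h1 h2
    obtain ⟨S', i'⟩ := q
    simp only at h1 h2 ⊢
    subst h2
    rw [hyi _ h1]
  have hmem : ∀ u ∈ E ∪ P.biUnion id, u ∈ E ∨ ∃ S i, y S i = u := by
    intro u hu
    rcases Finset.mem_union.1 hu with hu | hu
    · exact Or.inl hu
    · obtain ⟨S, hS, huS⟩ := Finset.mem_biUnion.1 hu
      obtain ⟨i, hi⟩ := (hyr ⟨S, hS⟩ u).1 huS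
      exact Or.inr ⟨_, i, hi⟩
  have hXm : ∀ S i, X S i ∈ F ∨ ∃ a < ℓ, X S i ∈ R (r a) := by
    intro S i
    rcases Finset.mem_union.1 (hX3 S (Finset.mem_univ _) i) with h1 | h1
    · exact Or.inl h1
    · obtain ⟨a, ha, h2⟩ := Finset.mem_biUnion.1 h1
      exact Or.inr ⟨a, Finset.mem_range.1 ha, h2⟩
  have hXne : ∀ S i, ∀ u ∈ E, φ u ≠ X S i := by
    intro S i u hu he
    rcases hXm S i with h1 | ⟨a, ha, h1⟩
    · exact hF u hu (he ▸ h1)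
    · exact hRA a ha u hu (he ▸ h1)
  refine ⟨φ', ?_, ?_, ?_⟩
  · intro u hu v hv huv
    rcases hmem u hu with hu | ⟨S, i, rfl⟩ <;> rcases hmem v hv with hv | ⟨S', i', rfl⟩
    · rw [hφ1 u hu, hφ1 v hv] at huv
      exact hinj hu hv huv
    · rw [hφ1 u hu, hφ2] at huv
      exact absurd huv (hXne _ _ u hu)
    · rw [hφ1 v hv, hφ2] at huv
      exact absurd huv.symm (hXne _ _ v hv)
    · rw [hφ2, hφ2] at huv
      by_cases hS : S = S'
      · subst hS
        rw [(hX1 S (Finset.mem_univ _)).1 huv]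
      · exact absurd huv (hX2 S (Finset.mem_univ _) S' (Finset.mem_univ _) hS i i')
  · intro u hu v hv huv
    rcases hmem u hu with hu | ⟨S, i, rfl⟩ <;> rcases hmem v hv with hv | ⟨S', i', rfl⟩
    · rw [hφ1 u hu, hφ1 v hv]
      exact hhom u hu v hv huv
    · rw [hφ1 u hu, hφ2]
      exact (hX1 S' (Finset.mem_univ _)).2.2 i' _
        (Finset.mem_image_of_mem _ (Finset.mem_filter.2 ⟨hu, huv.symm⟩))
    · rw [hφ1 v hv, hφ2]
      exact ((hX1 S (Finset.mem_univ _)).2.2 i _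
        (Finset.mem_image_of_mem _ (Finset.mem_filter.2 ⟨hv, huv⟩))).symm
    · rw [hφ2, hφ2]
      by_cases hS : S = S'
      · subst hS
        exact (hX1 S (Finset.mem_univ _)).2.1 i i' huv
      · exact absurd huv (hfar' S S' hS i i').2.1
  · intro u hu
    rcases hmem u hu with hu | ⟨S, i, rfl⟩
    · exact Or.inl ⟨hu, hφ1 u hu⟩
    · rw [hφ2]
      exact Or.inr (hXm S i)

/-- `E'` can be reached from `E` in at most `t` steps. -/
def Reach {W : Type*} [Fintype W] (H : SimpleGraph W) (d gmax : ℕ) : ℕ → Finset W → Finset W → Prop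
  | 0, E, E' => E = E'
  | t + 1, E, E' => ∃ E₁, Reach H d gmax t E E₁ ∧ StepOK H d gmax E₁ E'

lemma StepOK.refl {W : Type*} [Fintype W] (H : SimpleGraph W) (d gmax : ℕ) (hg : 1 ≤ gmax)
    (E : Finset W) : StepOK H d gmax E E :=
  ⟨1, le_rfl, hg, ∅, by simp, by simp, by simp⟩

lemma Reach.trans {W : Type*} [Fintype W] {H : SimpleGraph W} {d gmax : ℕ} {E E₁ E₂ : Finset W}
    {s t : ℕ} (h1 : Reach H d gmax s E E₁) (h2 : Reach H d gmax t E₁ E₂) :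
    Reach H d gmax (s + t) E E₂ := by
  induction t generalizing E₂ with
  | zero => have : E₁ = E₂ := h2
            subst this; exact h1
  | succ t ih =>
    obtain ⟨E₃, h3, h4⟩ := h2
    exact ⟨E₃, ih h3, h4⟩

/-- The embedding lemma. -/
lemma embed_of_reach {n : ℕ} {G : SimpleGraph (Fin n)} {d gmax K T ℓ N : ℕ}
    {R : Fin N → Finset (Fin n)} (h : PR G d gmax K N R) (hK : 1 ≤ K) (hℓ : K < 2 ^ ℓ)
    (hpos : 0 < n) (r : ℕ → ℕ → Fin N)
    (hRc : ∀ a, (R a).card = 2 * (gmax * K))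
    (hrinj : ∀ t < T, ∀ t' < T, ∀ a < ℓ, ∀ a' < ℓ, r t a = r t' a' → t = t' ∧ a = a')
    (hRd : ∀ a b, a ≠ b → Disjoint (R a) (R b))
    {W : Type*} [Fintype W] {H : SimpleGraph W}
    (hn : gmax * K + Fintype.card W + N * (2 * (gmax * K)) ≤ n)
    (hreach : Reach H d gmax T ∅ Finset.univ) : ContainsCopy H G := by
  classical
  have key : ∀ t ≤ T, ∀ E, Reach H d gmax t ∅ E → ∃ φ : W → Fin n, Set.InjOn φ E ∧
      (∀ u ∈ E, ∀ v ∈ E, H.Adj u v → G.Adj (φ u) (φ v)) ∧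
      ∀ u ∈ E, ∀ t' < T, t ≤ t' → ∀ a < ℓ, φ u ∉ R (r t' a) := by
    intro t
    induction t with
    | zero =>
      intro _ E hE
      have hE : ∅ = E := hE
      subst hE
      exact ⟨fun _ => ⟨0, hpos⟩, by simp, by simp, by simp⟩
    | succ t ih =>
      intro ht E' hE'
      obtain ⟨E, hE, hst⟩ := hE'
      obtain ⟨φ, hinj, hhom, hav⟩ := ih (by omega) E hE
      let F : Finset (Fin n) := Finset.univ \ (Finset.univ.biUnion R ∪ E.image φ)
      have hFR : ∀ a, Disjoint F (R a) := by
        intro a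
        rw [Finset.disjoint_left]
        intro v hv hv'
        simp only [F, Finset.mem_sdiff, Finset.mem_union, Finset.mem_biUnion] at hv
        exact hv.2 (Or.inl ⟨a, Finset.mem_univ _, hv'⟩)
      have hFc : n ≤ F.card + (N * (2 * (gmax * K)) + E.card) := by
        have h1 : (Finset.univ.biUnion R ∪ E.image φ).card ≤ N * (2 * (gmax * K)) + E.card := by
          refine (Finset.card_union_le _ _).trans (add_le_add ?_ Finset.card_image_le)
          refine Finset.card_biUnion_le.trans ?_
          rw [Finset.sum_congr rfl (fun a _ => hRc a)]
          simp
        have h2 := Finset.le_card_sdiff (Finset.univ.biUnion R ∪ E.image φ)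
          (Finset.univ : Finset (Fin n))
        simp only [Finset.card_univ, Fintype.card_fin] at h2
        simp only [F]
        omega
      have hEc := Finset.card_le_univ E
      obtain ⟨φ', h1, h2, h3⟩ := extend_step h hK hst φ hinj hhom F (by
          intro u hu hF
          simp only [F, Finset.mem_sdiff, Finset.mem_union] at hF
          exact hF.2 (Or.inr (Finset.mem_image_of_mem _ hu))) (by omega)
        (r t) (fun a => hRc _) ℓ hℓ (fun a ha u hu => hav u hu t (by omega) le_rfl a ha)
        (fun a ha b hb hab => hRd _ _ (fun he => hab (hrinj t (by omega) t (by omega) a ha b hb he).2))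
        (fun a _ => hFR _)
      refine ⟨φ', h1, h2, ?_⟩
      intro u hu t' ht' htt a ha hm
      rcases h3 u hu with ⟨hu, he⟩ | hF | ⟨b, hb, hR⟩
      · rw [he] at hm
        exact hav u hu t' ht' (by omega) a ha hm
      · exact Finset.disjoint_left.1 (hFR _) hF hm
      · have hne : r t b ≠ r t' a := by
          intro he
          have := (hrinj t (by omega) t' ht' b hb a ha he).1
          omega
        exact Finset.disjoint_left.1 (hRd _ _ hne) hR hm
  obtain ⟨φ, h1, h2, -⟩ := key T le_rfl _ hreach
  refine ⟨φ, ?_, ?_⟩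
  · intro u v huv
    exact h1 (by simp) (by simp) huv
  · intro u v huv
    exact h2 u (by simp) v (by simp) huv

end PartE2

section PartF

open MeasureTheory Filter Topology

set_option linter.unusedSectionVars false

/-! ### Structure of graphs of bounded degree -/

section structureH

variable {W : Type*} [Fintype W] (H : SimpleGraph W)

lemma Far.symm {H : SimpleGraph W} {x y : W} (h : Far H x y) : Far H y x :=
  ⟨h.1.symm, fun h' => h.2.1 h'.symm, fun z hz => h.2.2 z ⟨hz.2, hz.1⟩⟩

open Classical in
lemma eIn_mono {I I' : Finset W} (h : I ⊆ I') : eIn H I ≤ eIn H I' := by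
  unfold eIn
  refine Finset.card_le_card ?_
  intro e he
  simp only [Finset.mem_filter] at he ⊢
  exact ⟨he.1, fun v hv => h (he.2 v hv)⟩

open Classical in
lemma eIn_small {I : Finset W} (h : I.card ≤ 1) : eIn H I = 0 := by
  unfold eIn
  rw [Finset.card_eq_zero, Finset.filter_eq_empty_iff]
  intro e he hI
  induction e with | _ a b
  simp only [SimpleGraph.mem_edgeFinset, SimpleGraph.mem_edgeSet] at he
  exact he.ne (Finset.card_le_one.1 h a (hI a (by simp)) b (hI b (by simp)))

open Classical in
lemma eIn_union (I I' : Finset W) : eIn H I + eIn H I' ≤ eIn H (I ∪ I') + eIn H (I ∩ I') := by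
  unfold eIn
  rw [← Finset.card_union_add_card_inter, ← Finset.filter_or, ← Finset.filter_and]
  refine add_le_add (Finset.card_le_card ?_) (Finset.card_le_card ?_)
  · intro e he
    simp only [Finset.mem_filter, Finset.mem_union] at he ⊢
    refine ⟨he.1, fun v hv => ?_⟩
    rcases he.2 with h | h
    · exact Or.inl (h v hv)
    · exact Or.inr (h v hv)
  · intro e he
    simp only [Finset.mem_filter, Finset.mem_inter] at he ⊢
    exact ⟨he.1, fun v hv => ⟨he.2.1 v hv, he.2.2 v hv⟩⟩

open Classical in
lemma eIn_insert {x : W} {U : Finset W} (hx : x ∉ U) :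
    eIn H U + (U.filter (H.Adj x)).card ≤ eIn H (insert x U) := by
  unfold eIn
  have h1 : (U.filter (H.Adj x)).card = ((U.filter (H.Adj x)).image (fun y => s(x, y))).card := by
    rw [Finset.card_image_of_injective]
    intro a b hab
    exact Sym2.congr_right.1 hab
  rw [h1, ← Finset.card_union_of_disjoint]
  · refine Finset.card_le_card ?_
    intro e he
    rcases Finset.mem_union.1 he with he | he
    · simp only [Finset.mem_filter] at he ⊢
      exact ⟨he.1, fun v hv => Finset.mem_insert_of_mem (he.2 v hv)⟩
    · obtain ⟨y, hy, rfl⟩ := Finset.mem_image.1 he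
      rw [Finset.mem_filter] at hy
      simp [hy.1, hy.2]
  · rw [Finset.disjoint_left]
    intro e he he'
    obtain ⟨y, hy, rfl⟩ := Finset.mem_image.1 he'
    rw [Finset.mem_filter] at he
    exact hx (he.2 x (by simp))

open Classical in
/-- Edges inside `S` containing `x`. -/
noncomputable def eAt (S : Finset W) (x : W) : ℕ :=
  ((H.edgeFinset.filter (fun e => ∀ v ∈ e, v ∈ S)).filter (fun e => x ∈ e)).card

open Classical in
lemma eIn_erase (S : Finset W) (x : W) : eIn H S ≤ eIn H (S.erase x) + eAt H S x := by
  unfold eIn eAt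
  rw [← Finset.card_filter_add_card_filter_not (s := H.edgeFinset.filter (fun e => ∀ v ∈ e, v ∈ S))
    (fun e => x ∈ e), add_comm]
  gcongr
  intro e he
  simp only [Finset.mem_filter, Finset.mem_erase] at he ⊢
  refine ⟨he.1.1, fun v hv => ⟨?_, he.1.2 v hv⟩⟩
  rintro rfl
  exact he.2 hv

open Classical in
lemma eAt_le (S : Finset W) (x : W) : eAt H S x ≤ (S.filter (H.Adj x)).card := by
  unfold eAt
  refine (Finset.card_le_card (t := (S.filter (H.Adj x)).image (fun y => s(x, y))) ?_).trans
    Finset.card_image_le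
  intro e he
  simp only [Finset.mem_filter] at he
  obtain ⟨⟨he1, he2⟩, he3⟩ := he
  obtain ⟨y, rfl⟩ := Sym2.mem_iff_exists.1 he3
  simp only [SimpleGraph.mem_edgeFinset, SimpleGraph.mem_edgeSet] at he1
  refine Finset.mem_image.2 ⟨y, ?_, rfl⟩
  rw [Finset.mem_filter]
  exact ⟨he2 y (by simp), he1⟩

open Classical in
lemma sum_eAt (S : Finset W) : ∑ x ∈ S, eAt H S x ≤ 2 * eIn H S := by
  unfold eAt eIn
  have h := Finset.sum_card_bipartiteAbove_eq_sum_card_bipartiteBelow (s := S)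
    (t := H.edgeFinset.filter (fun e => ∀ v ∈ e, v ∈ S)) (fun x e => x ∈ e)
  unfold Finset.bipartiteAbove Finset.bipartiteBelow at h
  rw [h, mul_comm]
  refine Finset.sum_le_card_nsmul _ _ 2 ?_
  intro e _
  induction e with | _ a b
  refine (Finset.card_le_card (t := {a, b}) ?_).trans Finset.card_le_two
  intro x hx
  simpa using (Finset.mem_filter.1 hx).2

open Classical in
/-- Every set spanning at least as many edges as vertices contains a core. -/
lemma exists_core (T : Finset W) (hT : T.Nonempty) (he : T.card ≤ eIn H T) :
    ∃ S ⊆ T, S.Nonempty ∧ (∀ I ⊆ S, eIn H I ≤ I.card) ∧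
      ∀ x ∈ S, 2 ≤ (S.filter (H.Adj x)).card := by
  let Fam := T.powerset.filter (fun S => S.Nonempty ∧ S.card ≤ eIn H S)
  have hF : Fam.Nonempty := ⟨T, by simp [Fam, hT, he]⟩
  obtain ⟨S, hS, hmin⟩ := Finset.exists_min_image Fam Finset.card hF
  simp only [Fam, Finset.mem_filter, Finset.mem_powerset] at hS hmin
  obtain ⟨hST, hSn, hSe⟩ := hS
  have hprop : ∀ I ⊂ S, I.Nonempty → eIn H I < I.card := by
    intro I hI hIn
    by_contra hcon
    have := hmin I ⟨hI.1.trans hST, hIn, by omega⟩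
    have := Finset.card_lt_card hI
    omega
  have hdeg : ∀ x ∈ S, eIn H S + 2 ≤ S.card + eAt H S x := by
    intro x hx
    have h1 := eIn_erase H S x
    have h2 := Finset.card_erase_of_mem hx
    have h3 : 0 < S.card := hSn.card_pos
    by_cases h4 : (S.erase x).Nonempty
    · have := hprop _ (Finset.erase_ssubset hx) h4
      omega
    · rw [Finset.not_nonempty_iff_eq_empty] at h4
      rw [h4] at h2
      have := eIn_small H (I := S) (by simp at h2; omega)
      omega
  have hdeg2 : ∀ x ∈ S, 2 ≤ (S.filter (H.Adj x)).card := by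
    intro x hx
    have := hdeg x hx
    have := eAt_le H S x
    omega
  have h3 : ∀ x ∈ S, eAt H S x + 1 ≤ S.card := by
    intro x hx
    have h1 := eAt_le H S x
    have : (S.filter (H.Adj x)).card ≤ (S.erase x).card := by
      refine Finset.card_le_card ?_
      intro y hy
      rw [Finset.mem_filter] at hy
      exact Finset.mem_erase.2 ⟨hy.2.ne', hy.1⟩
    rw [Finset.card_erase_of_mem hx] at this
    have h3 : 0 < S.card := hSn.card_pos
    omega
  have heq : eIn H S = S.card := by
    obtain ⟨t, ht⟩ := Nat.exists_eq_add_of_le hSe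
    have h4 : S.card * (t + 2) ≤ ∑ x ∈ S, eAt H S x := by
      rw [← smul_eq_mul]
      refine Finset.card_nsmul_le_sum _ _ _ ?_
      intro x hx
      have := hdeg x hx
      omega
    have h5 := sum_eAt H S
    obtain ⟨x, hx⟩ := hSn
    have h6 := h3 x hx
    have h7 := hdeg x hx
    rw [ht] at h5 h7 ⊢
    have h8 : S.card * t ≤ 2 * t := by nlinarith
    have h9 : 3 ≤ S.card := by omega
    have : t = 0 := by nlinarith
    omega
  refine ⟨S, hST, hSn, ?_, hdeg2⟩
  intro I hI
  rcases eq_or_ne I S with rfl | hne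
  · exact heq.le
  · rcases I.eq_empty_or_nonempty with rfl | hn
    · simp [eIn_small H (I := ∅) (by simp)]
    · exact (hprop I (lt_of_le_of_ne hI hne) hn).le

open Classical in
/-- Iterated neighbourhoods. -/
noncomputable def Bs (Z : Finset W) : ℕ → Finset W
  | 0 => Z
  | i + 1 => Bs Z i ∪ Finset.univ.filter (fun x => ∃ a ∈ Bs Z i, H.Adj a x)

lemma Bs_succ_sub (Z : Finset W) (i : ℕ) : Bs H Z i ⊆ Bs H Z (i + 1) := by
  classical
  rw [Bs]
  intro x hx
  simp [hx]

lemma Bs_mono (Z : Finset W) {i j : ℕ} (h : i ≤ j) : Bs H Z i ⊆ Bs H Z j :=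
  monotone_nat_of_le_succ (f := Bs H Z) (Bs_succ_sub H Z) h

lemma mem_Bs_succ {Z : Finset W} {i : ℕ} {x : W} :
    x ∈ Bs H Z (i + 1) ↔ x ∈ Bs H Z i ∨ ∃ a ∈ Bs H Z i, H.Adj a x := by
  classical
  rw [Bs]
  simp

lemma Bs_symm {Z : Finset W} {v : W} (i : ℕ) : ∀ (j : ℕ) (x : W), x ∈ Bs H {v} i → x ∈ Bs H Z j →
    v ∈ Bs H Z (j + i) := by
  induction i with
  | zero =>
    intro j x hx hj
    have : x = v := by simpa [Bs] using hx
    subst this; exact hj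
  | succ i ih =>
    intro j x hx hj
    rcases (mem_Bs_succ H).1 hx with h | ⟨a, ha, hadj⟩
    · exact Bs_mono H Z (by omega) (ih j x h hj)
    · have : a ∈ Bs H Z (j + 1) := (mem_Bs_succ H).2 (Or.inr ⟨x, hj, hadj.symm⟩)
      have := ih (j + 1) a ha this
      rwa [show j + (i + 1) = j + 1 + i by ring]

open Classical in
/-- Either a vertex of small degree or a dense small set nearby. -/
lemma near_dense (ℓ : ℕ) (hW : Fintype.card W < 2 ^ ℓ) (v : W) :
    (∃ x ∈ Bs H {v} ℓ, (Finset.univ.filter (H.Adj x)).card < 3) ∨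
      ∃ T ⊆ Bs H {v} ℓ, T.Nonempty ∧ T.card ≤ 2 * ℓ + 2 ∧ T.card ≤ eIn H T := by
  by_contra hcon
  push Not at hcon
  obtain ⟨hdeg, hT⟩ := hcon
  have hv : ∀ i, v ∈ Bs H {v} i := fun i => Bs_mono H _ (Nat.zero_le i) (by simp [Bs])
  have hQ : ∀ i, ∀ x ∈ Bs H {v} i, ∃ Q : Finset W, v ∈ Q ∧ x ∈ Q ∧ Q ⊆ Bs H {v} i ∧
      Q.card ≤ i + 1 ∧ Q.card ≤ eIn H Q + 1 ∧
      ∀ z ∈ Q, z ≠ x → ∃ j, z ∈ Bs H {v} j ∧ x ∉ Bs H {v} j := by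
    intro i
    induction i with
    | zero =>
      intro x hx
      have : x = v := by simpa [Bs] using hx
      subst this
      exact ⟨{x}, by simp, by simp, by simp [Bs], by simp, by simp, by simp⟩
    | succ i ih =>
      intro x hx
      by_cases hxi : x ∈ Bs H {v} i
      · obtain ⟨Q, h1, h2, h3, h4, h5, h6⟩ := ih x hxi
        exact ⟨Q, h1, h2, h3.trans (Bs_succ_sub H _ i), by omega, h5, h6⟩
      · rcases (mem_Bs_succ H).1 hx with h | ⟨a, ha, hadj⟩
        · exact absurd h hxi
        obtain ⟨Q, h1, h2, h3, h4, h5, h6⟩ := ih a ha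
        have hxQ : x ∉ Q := fun h => hxi (h3 h)
        have hc := eIn_insert H hxQ
        have hpos : 0 < (Q.filter (H.Adj x)).card :=
          Finset.card_pos.2 ⟨a, Finset.mem_filter.2 ⟨h2, hadj.symm⟩⟩
        have hcc := Finset.card_insert_of_notMem hxQ
        refine ⟨insert x Q, by simp [h1], by simp, ?_, by omega, by omega, ?_⟩
        · intro z hz
          rcases Finset.mem_insert.1 hz with rfl | hz
          · exact hx
          · exact Bs_succ_sub H _ i (h3 hz)
        · intro z hz hzx
          rcases Finset.mem_insert.1 hz with rfl | hz
          · exact absurd rfl hzx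
          · exact ⟨i, h3 hz, hxi⟩
  -- at most one neighbour in lower or equal levels
  have hone : ∀ i, i + 1 ≤ ℓ → ∀ y ∈ Bs H {v} (i + 1), y ∉ Bs H {v} i →
      ((Bs H {v} (i + 1)).filter (H.Adj y)).card ≤ 1 := by
    intro i hi y hy hyi
    rw [Finset.card_le_one]
    intro a ha b hb
    by_contra hab
    rw [Finset.mem_filter] at ha hb
    have hyQ : ∀ c ∈ Bs H {v} (i + 1), H.Adj y c → ∀ Q : Finset W,
        (∀ z ∈ Q, z ≠ c → ∃ j, z ∈ Bs H {v} j ∧ c ∉ Bs H {v} j) → y ∉ Q := by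
      intro c hc hadj Q hQ hyQ
      obtain ⟨j, hj1, hj2⟩ := hQ y hyQ hadj.ne
      have hji : i + 1 ≤ j := by
        by_contra hlt
        exact hyi (Bs_mono H _ (by omega) hj1)
      exact hj2 (Bs_mono H _ hji hc)
    obtain ⟨Q, h1, h2, h3, h4, h5, h6⟩ := hQ _ a ha.1
    obtain ⟨Q', h1', h2', h3', h4', h5', h6'⟩ := hQ _ b hb.1
    have hy1 := hyQ a ha.1 ha.2 Q h6
    have hy2 := hyQ b hb.1 hb.2 Q' h6'
    have hyU : y ∉ Q ∪ Q' := by simp [hy1, hy2]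
    have hc1 := eIn_insert H hyU
    have hpos : 2 ≤ ((Q ∪ Q').filter (H.Adj y)).card := by
      have : ({a, b} : Finset W) ⊆ (Q ∪ Q').filter (H.Adj y) := by
        intro z hz
        rcases Finset.mem_insert.1 hz with rfl | hz
        · simp [h2, ha.2]
        · rw [Finset.mem_singleton] at hz
          subst hz
          simp [h2', hb.2]
      have h := Finset.card_le_card this
      rwa [Finset.card_pair hab] at h
    have hcc := Finset.card_insert_of_notMem hyU
    have hun := eIn_union H Q Q'
    have hui := Finset.card_union_add_card_inter Q Q'
    have hBl : Bs H {v} (i + 1) ⊆ Bs H {v} ℓ := Bs_mono H _ hi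
    have hin : 0 < (Q ∩ Q').card := Finset.card_pos.2 ⟨v, by simp [h1, h1']⟩
    have hTi := hT (Q ∩ Q') ((Finset.inter_subset_left).trans (h3.trans hBl))
      (Finset.card_pos.1 hin) (by
        have := Finset.card_le_card (Finset.inter_subset_left (s₁ := Q) (s₂ := Q'))
        omega)
    have hTu := hT (insert y (Q ∪ Q')) (by
      refine Finset.insert_subset (hBl hy) (Finset.union_subset (h3.trans hBl) (h3'.trans hBl)))
      (Finset.insert_nonempty _ _) (by omega)
    omega
  let L : ℕ → Finset W := fun i => match i with
    | 0 => {v}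
    | i + 1 => Bs H {v} (i + 1) \ Bs H {v} i
  have hLB : ∀ i, L i ⊆ Bs H {v} i := by
    intro i
    cases i with
    | zero => simp [L, Bs]
    | succ i => exact Finset.sdiff_subset
  have honeL : ∀ i ≤ ℓ, ∀ y ∈ L i, ((Bs H {v} i).filter (H.Adj y)).card ≤ 1 := by
    intro i hi y hy
    cases i with
    | zero =>
      refine (Finset.card_le_card (Finset.filter_subset _ _)).trans ?_
      simp [Bs]
    | succ i =>
      have hy : y ∈ Bs H {v} (i + 1) \ Bs H {v} i := hy
      rw [Finset.mem_sdiff] at hy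
      exact hone i hi y hy.1 hy.2
  have hgrow : ∀ i ≤ ℓ, 2 ^ i ≤ (L i).card := by
    intro i
    induction i with
    | zero => intro _; simp [L]
    | succ i ih =>
      intro hi
      have h1 := ih (by omega)
      have h2 : (L i).card * 2 ≤ (L (i + 1)).card * 1 := by
        refine Finset.card_mul_le_card_mul H.Adj ?_ ?_
        · intro y hy
          have h3 := hdeg y (Bs_mono H _ (by omega) (hLB i hy))
          have h4 := honeL i (by omega) y hy
          have h5 : Finset.univ.filter (H.Adj y) ⊆ (Bs H {v} i).filter (H.Adj y) ∪
              (L (i + 1)).bipartiteAbove H.Adj y := by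
            intro z hz
            rw [Finset.mem_filter] at hz
            rw [Finset.mem_union, Finset.mem_filter, Finset.mem_bipartiteAbove]
            by_cases hzB : z ∈ Bs H {v} i
            · exact Or.inl ⟨hzB, hz.2⟩
            · refine Or.inr ⟨?_, hz.2⟩
              exact Finset.mem_sdiff.2 ⟨(mem_Bs_succ H).2 (Or.inr ⟨y, hLB i hy, hz.2⟩), hzB⟩
          have h6 := (Finset.card_le_card h5).trans (Finset.card_union_le _ _)
          omega
        · intro z hz
          refine (Finset.card_le_card ?_).trans (honeL (i + 1) hi z hz)
          intro y hy
          rw [Finset.mem_bipartiteBelow] at hy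
          rw [Finset.mem_filter]
          exact ⟨Bs_succ_sub H _ i (hLB i hy.1), hy.2.symm⟩
      rw [pow_succ]
      omega
  have := hgrow ℓ le_rfl
  have := Finset.card_le_univ (L ℓ)
  omega

open Classical in
/-- Greedy colouring of the square. -/
lemma exists_col (Δ : ℕ) (hdeg : ∀ x, (Finset.univ.filter (H.Adj x)).card ≤ Δ) :
    ∃ col : W → ℕ, (∀ x, col x < Δ * Δ + Δ + 1) ∧ ∀ x y, x ≠ y → col x = col y → Far H x y := by
  have key : ∀ s : Finset W, ∃ col : W → ℕ, (∀ x, col x < Δ * Δ + Δ + 1) ∧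
      ∀ x ∈ s, ∀ y ∈ s, x ≠ y → col x = col y → Far H x y := by
    intro s
    induction s using Finset.induction_on with
    | empty => exact ⟨fun _ => 0, by simp, by simp⟩
    | insert a s ha ih =>
      obtain ⟨col, h1, h2⟩ := ih
      let Nb : Finset W := Finset.univ.filter (H.Adj a) ∪
        (Finset.univ.filter (H.Adj a)).biUnion (fun z => Finset.univ.filter (H.Adj z))
      have hNb : Nb.card ≤ Δ * Δ + Δ := by
        refine (Finset.card_union_le _ _).trans ?_
        rw [add_comm]
        refine add_le_add ?_ (hdeg a)
        refine Finset.card_biUnion_le.trans ?_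
        refine (Finset.sum_le_card_nsmul _ _ Δ (fun z _ => hdeg z)).trans ?_
        rw [smul_eq_mul]
        exact Nat.mul_le_mul_right _ (hdeg a)
      have hne : ((Finset.range (Δ * Δ + Δ + 1)) \ Nb.image col).Nonempty := by
        rw [← Finset.card_pos]
        have e1 := Finset.le_card_sdiff (Nb.image col) (Finset.range (Δ * Δ + Δ + 1))
        have e2 : (Nb.image col).card ≤ Nb.card := Finset.card_image_le
        rw [Finset.card_range] at e1
        omega
      obtain ⟨c, hc⟩ := hne
      rw [Finset.mem_sdiff, Finset.mem_range] at hc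
      have hfar : ∀ y, y ≠ a → col y = c → Far H a y := by
        intro y hy hcy
        have hyN : y ∉ Nb := fun h => hc.2 (Finset.mem_image.2 ⟨y, h, hcy⟩)
        simp only [Nb, Finset.mem_union, Finset.mem_filter, Finset.mem_univ, true_and,
          Finset.mem_biUnion, not_or, not_exists, not_and] at hyN
        exact ⟨hy.symm, hyN.1, fun z hz => hyN.2 z hz.1 hz.2.symm⟩
      refine ⟨Function.update col a c, ?_, ?_⟩
      · intro x
        by_cases hx : x = a
        · subst hx; simpa using hc.1
        · simpa [hx] using h1 x
      · intro x hx y hy hxy hcol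
        by_cases hxa : x = a
        · subst hxa
          have hya : y ≠ x := hxy.symm
          simp only [Function.update_self, Function.update_of_ne hya] at hcol
          exact hfar y hya hcol.symm
        · by_cases hya : y = a
          · subst hya
            simp only [Function.update_self, Function.update_of_ne hxa] at hcol
            exact (hfar x hxa hcol).symm
          · simp only [Function.update_of_ne hxa, Function.update_of_ne hya] at hcol
            exact h2 x (by simpa [hxa] using hx) y (by simpa [hya] using hy) hxy hcol
  obtain ⟨col, h1, h2⟩ := key Finset.univ
  exact ⟨col, h1, fun x y hxy => h2 x (Finset.mem_univ _) y (Finset.mem_univ _) hxy⟩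

open Classical in
lemma reach_layer {d gmax c : ℕ} (hg : 1 ≤ gmax) (col : W → ℕ) (hcol : ∀ x, col x < c)
    (hfar : ∀ x y, x ≠ y → col x = col y → Far H x y) {E E' : Finset W} (hE : E ⊆ E')
    (hd : ∀ v ∈ E', v ∉ E → (E'.filter (H.Adj v)).card ≤ d) : Reach H d gmax c E E' := by
  have key : ∀ k, Reach H d gmax k E (E ∪ E'.filter (fun v => col v < k)) := by
    intro k
    induction k with
    | zero => simp [Reach]
    | succ k ih =>
      refine ⟨_, ih, 1, le_rfl, hg,
        ((E' \ E).filter (fun v => col v = k)).image (fun v => {v}), ?_, ?_, ?_⟩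
      · intro S hS
        obtain ⟨v, hv, rfl⟩ := Finset.mem_image.1 hS
        simp only [Finset.mem_filter, Finset.mem_sdiff] at hv
        refine ⟨by simp, ?_, ?_⟩
        · simp only [Finset.disjoint_singleton_left, Finset.mem_union, Finset.mem_filter]
          rintro (h | h)
          · exact hv.1.2 h
          · omega
        · intro I hI
          have hIc : I.card ≤ 1 := (Finset.card_le_card hI).trans (by simp)
          rw [eIn_small H hIc]
          refine ⟨?_, Nat.zero_le _⟩
          rcases Finset.subset_singleton_iff.1 hI with rfl | rfl
          · simp
          · simp only [Finset.sum_singleton, Finset.card_singleton, add_zero, mul_one]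
            refine (Finset.card_le_card ?_).trans (hd v hv.1.1 hv.1.2)
            refine Finset.filter_subset_filter _ ?_
            exact Finset.union_subset hE (Finset.filter_subset _ _)
      · intro S hS S' hS' hne x hx y hy
        obtain ⟨v, hv, rfl⟩ := Finset.mem_image.1 hS
        obtain ⟨v', hv', rfl⟩ := Finset.mem_image.1 hS'
        rw [Finset.mem_singleton] at hx hy
        subst hx hy
        rw [Finset.mem_filter] at hv hv'
        exact hfar _ _ (fun h => hne (by rw [h])) (by rw [hv.2, hv'.2])
      · ext w
        simp only [Finset.mem_union, Finset.mem_filter, Finset.mem_biUnion, Finset.mem_image,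
          Finset.mem_sdiff, id]
        constructor
        · rintro (h | ⟨h, h'⟩)
          · exact Or.inl (Or.inl h)
          · by_cases hw : w ∈ E
            · exact Or.inl (Or.inl hw)
            · by_cases hk : col w < k
              · exact Or.inl (Or.inr ⟨h, hk⟩)
              · exact Or.inr ⟨{w}, ⟨w, ⟨⟨h, hw⟩, by omega⟩, rfl⟩, by simp⟩
        · rintro ((h | ⟨h, h'⟩) | ⟨S, ⟨v, ⟨⟨h, hw⟩, hk⟩, rfl⟩, hwv⟩)
          · exact Or.inl h
          · exact Or.inr ⟨h, by omega⟩
          · rw [Finset.mem_singleton] at hwv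
            subst hwv
            exact Or.inr ⟨h, by omega⟩
  have h := key c
  have he : E ∪ E'.filter (fun v => col v < c) = E' := by
    ext w
    simp only [Finset.mem_union, Finset.mem_filter, hcol, and_true]
    exact ⟨fun h => h.elim (fun h => hE h) id, Or.inr⟩
  rwa [he] at h

open Classical in
/-- A core: sparse inside, with few edges leaving each vertex. -/
def IsCore (gmax : ℕ) (S : Finset W) : Prop :=
  S.Nonempty ∧ S.card ≤ gmax ∧ (∀ I ⊆ S, eIn H I ≤ I.card) ∧
    ∀ x ∈ S, 2 ≤ (S.filter (H.Adj x)).card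

open Classical in
lemma reach_cores {d gmax : ℕ} (hd2 : 2 ≤ d)
    (hdeg : ∀ x, (Finset.univ.filter (H.Adj x)).card ≤ d + 1)
    (P : Finset (Finset W)) (hP : ∀ S ∈ P, IsCore H gmax S)
    (hfar : ∀ S ∈ P, ∀ S' ∈ P, S ≠ S' → ∀ x ∈ S, ∀ y ∈ S', Far H x y) :
    Reach H d gmax gmax (Finset.univ \ P.biUnion id) Finset.univ := by
  have key : ∀ k ≤ gmax, Reach H d gmax k (Finset.univ \ P.biUnion id)
      (Finset.univ \ (P.filter (fun S => k < S.card)).biUnion id) := by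
    intro k
    induction k with
    | zero =>
      intro _
      have : P.filter (fun S => 0 < S.card) = P := by
        rw [Finset.filter_eq_self]
        exact fun S hS => (hP S hS).1.card_pos
      rw [this]
      rfl
    | succ k ih =>
      intro hk
      refine ⟨_, ih (by omega), k + 1, by omega, hk, P.filter (fun S => S.card = k + 1), ?_, ?_, ?_⟩
      · intro S hS
        rw [Finset.mem_filter] at hS
        obtain ⟨h1, h2, h3, h4⟩ := hP S hS.1
        have hdisj : Disjoint S (Finset.univ \ (P.filter (fun S => k < S.card)).biUnion id) := by
          rw [Finset.disjoint_left]
          intro x hx hx'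
          rw [Finset.mem_sdiff] at hx'
          refine hx'.2 (Finset.mem_biUnion.2 ⟨S, Finset.mem_filter.2 ⟨hS.1, by omega⟩, hx⟩)
        refine ⟨hS.2, hdisj, ?_⟩
        intro I hI
        have h5 := h3 I hI
        constructor
        · have h6 : ∑ x ∈ I, ((Finset.univ \ (P.filter (fun S => k < S.card)).biUnion id).filter
              (H.Adj x)).card ≤ I.card * (d - 1) := by
            rw [← smul_eq_mul]
            refine Finset.sum_le_card_nsmul _ _ _ ?_
            intro x hx
            have h7 := h4 x (hI hx)
            have h8 := hdeg x
            have h9 : ((Finset.univ \ (P.filter (fun S => k < S.card)).biUnion id).filter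
              (H.Adj x)).card + (S.filter (H.Adj x)).card ≤
              (Finset.univ.filter (H.Adj x)).card := by
              rw [← Finset.card_union_of_disjoint]
              · refine Finset.card_le_card ?_
                intro z hz
                simp only [Finset.mem_union, Finset.mem_filter] at hz
                simp only [Finset.mem_filter, Finset.mem_univ, true_and]
                tauto
              · exact (Finset.disjoint_filter_filter hdisj.symm)
            omega
          have h10 : I.card * (d - 1) + I.card = d * I.card := by
            obtain ⟨e, rfl⟩ : ∃ e, d = e + 1 := ⟨d - 1, by omega⟩
            simp only [Nat.add_sub_cancel]
            ring
          omega
        · by_cases hIc : I.card ≤ 1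
          · rw [eIn_small H hIc]
            exact Nat.zero_le _
          · have : 2 * (I.card - 1) ≤ d * (I.card - 1) := Nat.mul_le_mul_right _ hd2
            omega
      · intro S hS S' hS' hne
        exact hfar S (Finset.mem_filter.1 hS).1 S' (Finset.mem_filter.1 hS').1 hne
      · ext w
        simp only [Finset.mem_sdiff, Finset.mem_univ, true_and, Finset.mem_union,
          Finset.mem_biUnion, Finset.mem_filter, id, not_exists, not_and, and_imp]
        constructor
        · intro h
          by_cases hw : ∃ S ∈ P, S.card = k + 1 ∧ w ∈ S
          · obtain ⟨S, hS, h1, h2⟩ := hw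
            exact Or.inr ⟨S, ⟨hS, h1⟩, h2⟩
          · left
            intro S hS hk hwS
            by_cases h1 : S.card = k + 1
            · exact hw ⟨S, hS, h1, hwS⟩
            · exact h S hS (by omega) hwS
        · rintro (h | ⟨S, ⟨hS, h1⟩, hwS⟩) S' hS' hk' hwS'
          · exact h S' hS' (by omega) hwS'
          · have hne : S ≠ S' := by rintro rfl; omega
            exact (hfar S hS S' hS' hne w hwS w hwS').1 rfl
  have h := key gmax le_rfl
  have he : P.filter (fun S => gmax < S.card) = ∅ := by
    rw [Finset.filter_eq_empty_iff]
    intro S hS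
    have := (hP S hS).2.1
    omega
  rw [he] at h
  simpa using h

open Classical in
/-- Every graph of maximum degree at most `d+1` can be built in few steps. -/
lemma reach_univ {d ℓ : ℕ} (hd2 : 2 ≤ d)
    (hdeg : ∀ x, (Finset.univ.filter (H.Adj x)).card ≤ d + 1) (hW : Fintype.card W < 2 ^ ℓ) :
    Reach H d (2 * ℓ + 2)
      ((ℓ + 3) * ((d + 1) * (d + 1) + (d + 1) + 1) + (2 * ℓ + 2)) ∅ Finset.univ := by
  set c := (d + 1) * (d + 1) + (d + 1) + 1 with hc
  obtain ⟨col, hcol, hcf⟩ := exists_col H (d + 1) hdeg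
  -- maximal family of far apart cores
  let Fam : Finset (Finset (Finset W)) := Finset.univ.filter (fun P =>
    (∀ S ∈ P, IsCore H (2 * ℓ + 2) S) ∧
    (∀ S ∈ P, ∀ S' ∈ P, S ≠ S' → ∀ x ∈ S, ∀ y ∈ S', Far H x y))
  have hFam : Fam.Nonempty := ⟨∅, by simp [Fam]⟩
  obtain ⟨P, hP, hmax⟩ := Finset.exists_max_image Fam Finset.card hFam
  simp only [Fam, Finset.mem_filter, Finset.mem_univ, true_and] at hP hmax
  obtain ⟨hP, hfar⟩ := hP
  let Z0 := P.biUnion id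
  let low := Finset.univ.filter (fun x => (Finset.univ.filter (H.Adj x)).card ≤ d)
  let Z := low ∪ Z0
  have hball : Bs H Z (ℓ + 2) = Finset.univ := by
    rw [Finset.eq_univ_iff_forall]
    intro v
    rcases near_dense H ℓ hW v with ⟨x, hx, hlow⟩ | ⟨T, hT, hTn, hTc, hTe⟩
    · have : x ∈ Bs H Z 2 := Bs_mono H Z (Nat.zero_le 2) (by
        simp only [Bs, Z, low, Finset.mem_union, Finset.mem_filter, Finset.mem_univ, true_and]
        left; omega)
      rw [add_comm]
      exact Bs_symm H ℓ 2 x hx this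
    · obtain ⟨S, hST, hSn, hS1, hS2⟩ := exists_core H T hTn hTe
      have hcore : IsCore H (2 * ℓ + 2) S :=
        ⟨hSn, (Finset.card_le_card hST).trans hTc, hS1, hS2⟩
      have hx : ∃ x ∈ S, x ∈ Bs H Z 2 := by
        by_cases hSP : S ∈ P
        · obtain ⟨x, hx⟩ := hSn
          refine ⟨x, hx, Bs_mono H Z (Nat.zero_le 2) ?_⟩
          exact Finset.mem_union_right _ (Finset.mem_biUnion.2 ⟨S, hSP, hx⟩)
        · by_contra hcon
          push Not at hcon
          have hSfar : ∀ S' ∈ P, ∀ x ∈ S, ∀ y ∈ S', Far H x y := by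
            intro S' hS' x hx y hy
            have hyZ : y ∈ Bs H Z 0 :=
              Finset.mem_union_right _ (Finset.mem_biUnion.2 ⟨S', hS', hy⟩)
            have hxZ := hcon x hx
            refine ⟨?_, ?_, ?_⟩
            · rintro rfl
              exact hxZ (Bs_mono H Z (Nat.zero_le 2) hyZ)
            · intro hadj
              exact hxZ (Bs_succ_sub H Z 1 ((mem_Bs_succ H).2 (Or.inr ⟨y, hyZ, hadj.symm⟩)))
            · rintro z ⟨hz1, hz2⟩
              exact hxZ ((mem_Bs_succ H).2 (Or.inr ⟨z,
                (mem_Bs_succ H).2 (Or.inr ⟨y, hyZ, hz2⟩), hz1.symm⟩))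
          have := hmax (insert S P) ⟨?_, ?_⟩
          · rw [Finset.card_insert_of_notMem hSP] at this
            omega
          · intro S' hS'
            rcases Finset.mem_insert.1 hS' with rfl | h
            · exact hcore
            · exact hP S' h
          · intro S₁ h₁ S₂ h₂ hne x hx y hy
            rcases Finset.mem_insert.1 h₁ with e₁ | g₁ <;>
              rcases Finset.mem_insert.1 h₂ with e₂ | g₂
            · exact absurd (e₁.trans e₂.symm) hne
            · exact hSfar S₂ g₂ x (e₁ ▸ hx) y hy
            · exact (hSfar S₁ g₁ y (e₂ ▸ hy) x hx).symm
            · exact hfar S₁ g₁ S₂ g₂ hne x hx y hy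
      obtain ⟨x, hxS, hx2⟩ := hx
      rw [add_comm]
      exact Bs_symm H ℓ 2 x (hT (hST hxS)) hx2
  have hlayers : ∀ k ≤ ℓ + 2, Reach H d (2 * ℓ + 2) (k * c) ∅
      (Finset.univ \ Bs H Z (ℓ + 2 - k)) := by
    intro k
    induction k with
    | zero =>
      intro _
      rw [Nat.sub_zero, hball]
      simp [Reach]
    | succ k ih =>
      intro hk
      rw [show (k + 1) * c = k * c + c by ring]
      refine (ih (by omega)).trans ?_
      have e : ℓ + 2 - k = ℓ + 2 - (k + 1) + 1 := by omega
      rw [e]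
      refine reach_layer H (by omega) col hcol hcf ?_ ?_
      · exact Finset.sdiff_subset_sdiff le_rfl (Bs_succ_sub H Z _)
      · intro v hv hv'
        simp only [Finset.mem_sdiff, Finset.mem_univ, true_and, not_not] at hv hv'
        rcases (mem_Bs_succ H).1 hv' with h | ⟨a, ha, hadj⟩
        · exact absurd h hv
        have h1 : ((Finset.univ \ Bs H Z (ℓ + 2 - (k + 1))).filter (H.Adj v)) ⊂
            Finset.univ.filter (H.Adj v) := by
          refine (Finset.ssubset_iff_of_subset
            (Finset.filter_subset_filter _ (Finset.subset_univ _))).2 ⟨a, ?_, ?_⟩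
          · simp [hadj.symm]
          · intro h
            exact (Finset.mem_sdiff.1 (Finset.mem_filter.1 h).1).2 ha
        have := Finset.card_lt_card h1
        have := hdeg v
        omega
  have h1 := hlayers (ℓ + 2) le_rfl
  rw [Nat.sub_self] at h1
  have h2 : Reach H d (2 * ℓ + 2) c (Finset.univ \ Bs H Z 0) (Finset.univ \ Z0) := by
    refine reach_layer H (by omega) col hcol hcf ?_ ?_
    · refine Finset.sdiff_subset_sdiff le_rfl ?_
      exact Finset.subset_union_right
    · intro v hv hv'
      simp only [Finset.mem_sdiff, Finset.mem_univ, true_and, not_not] at hv hv'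
      rcases Finset.mem_union.1 hv' with h | h
      · refine (Finset.card_le_card (Finset.filter_subset_filter _ (Finset.subset_univ _))).trans ?_
        exact (Finset.mem_filter.1 h).2
      · exact absurd h hv
  have h3 := reach_cores H hd2 hdeg P hP hfar
  have h4 := (h1.trans h2).trans h3
  have e : (ℓ + 3) * c + (2 * ℓ + 2) = (ℓ + 2) * c + c + (2 * ℓ + 2) := by ring
  rw [e]
  exact h4

end structureH

end PartF

section PartG1

set_option maxHeartbeats 1000000 in
lemma numeric (d C1 : ℕ) (hC1 : 1 ≤ C1) (ε : ℝ) (hε : 0 < ε) :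
    ∀ᶠ ℓ : ℕ in Filter.atTop, ∀ (n K gmax N : ℕ) (p : ℝ), 0 < n → ℓ ≤ n → n < 2 ^ ℓ → K ≤ n →
      gmax = 2 * ℓ + 2 → N ≤ C1 * ℓ ^ 2 →
      ε * n ≤ 32 * C1 * (ℓ:ℝ) ^ 3 * K → 0 < p → (ℓ:ℝ) ^ 10 ≤ 3 ^ 10 * (n * p ^ d) →
      ∀ M : ℝ, M = 2 ^ (gmax * gmax) * ((n:ℝ) + 1) ^ ((d + 1) * gmax) *
        Real.exp (-(K * p ^ d / (24 * gmax ^ 2))) →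
      0 < K ∧ (gmax : ℝ) ≤ K * p ^ d ∧ M ≤ 1 ∧
      ((gmax:ℝ) + 1) * (K + 1) * N * M ≤ Real.exp (-(ℓ:ℝ)) ∧
      ((gmax:ℝ) + 1) * 2 ^ n * M ^ K ≤ Real.exp (-(ℓ:ℝ)) := by
  set c5 : ℝ := ε / (32 * C1) with hc5
  set a : ℝ := c5 / 3 ^ 10 with ha
  set b : ℝ := a / 384 with hb
  set C4 : ℝ := 16 + 4 * (d + 1) with hC4
  have hC1' : (1:ℝ) ≤ C1 := by exact_mod_cast hC1
  have hc5p : 0 < c5 := by positivity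
  have hap : 0 < a := by positivity
  have hbp : 0 < b := by positivity
  have hC4p : 0 < C4 := by positivity
  have ht : Filter.Tendsto (fun ℓ : ℕ => (ℓ:ℝ)) Filter.atTop Filter.atTop :=
    tendsto_natCast_atTop_atTop
  filter_upwards [ht.eventually_ge_atTop 5, ht.eventually_ge_atTop ((1 + C4) / b),
    ht.eventually_ge_atTop (4 / a), ht.eventually_ge_atTop (4 / c5),
    ht.eventually_ge_atTop (5 * C1)] with ℓ h1 h2 h3 h4 h5
  intro n K gmax N p hn hln hn2 hKn hgm hN hKlow hp hpd M hM
  set x : ℝ := (ℓ:ℝ) with hx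
  rw [div_le_iff₀ hbp] at h2
  rw [div_le_iff₀ hap] at h3
  rw [div_le_iff₀ hc5p] at h4
  have hx0 : 0 < x := by linarith
  have hnr : (0:ℝ) < n := by exact_mod_cast hn
  have hxn : x ≤ n := by rw [hx]; exact_mod_cast hln
  have hKr0 : (0:ℝ) ≤ K := Nat.cast_nonneg _
  have hgr : (gmax:ℝ) = 2 * x + 2 := by rw [hgm]; push_cast; rfl
  have hg4 : (gmax:ℝ) ≤ 4 * x := by linarith
  have hg0 : (0:ℝ) < gmax := by linarith
  have hNr : (N:ℝ) ≤ C1 * x ^ 2 := by rw [hx]; exact_mod_cast hN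
  have hpdp : 0 < p ^ d := pow_pos hp d
  have hKx : c5 * n ≤ x ^ 3 * K := by
    rw [hc5, div_mul_eq_mul_div, div_le_iff₀ (by positivity)]
    linarith
  have hKpos : 0 < K := by
    rcases Nat.eq_zero_or_pos K with h | h
    · rw [h] at hKx
      simp only [Nat.cast_zero, mul_zero] at hKx
      have : 0 < c5 * n := by positivity
      linarith
    · exact h
  have hL : a * x ^ 7 ≤ K * p ^ d := by
    have e1 : c5 * n * p ^ d ≤ x ^ 3 * K * p ^ d := mul_le_mul_of_nonneg_right hKx hpdp.le
    have e2 : a * x ^ 10 ≤ c5 * (n * p ^ d) := by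
      rw [ha, div_mul_eq_mul_div, div_le_iff₀ (by positivity)]
      have := mul_le_mul_of_nonneg_left hpd hc5p.le
      linarith
    have e3 : x ^ 3 * (a * x ^ 7) ≤ x ^ 3 * (K * p ^ d) := by
      calc _ = a * x ^ 10 := by ring
        _ ≤ _ := e2
        _ ≤ _ := by linarith
    exact le_of_mul_le_mul_left e3 (by positivity)
  have hgK : (gmax:ℝ) ≤ K * p ^ d := by
    refine le_trans ?_ hL
    have e1 : 1 ≤ x ^ 5 := one_le_pow₀ (by linarith)
    have e2 : 4 * x ≤ a * x ^ 7 := by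
      calc 4 * x ≤ (x * a) * x := mul_le_mul_of_nonneg_right h3 hx0.le
        _ = a * x ^ 2 * 1 := by ring
        _ ≤ a * x ^ 2 * x ^ 5 := mul_le_mul_of_nonneg_left e1 (by positivity)
        _ = _ := by ring
    linarith
  have hβ : b * x ^ 5 ≤ K * p ^ d / (24 * gmax ^ 2) := by
    rw [le_div_iff₀ (by positivity)]
    have e1 : (gmax:ℝ) ^ 2 ≤ (4 * x) ^ 2 := pow_le_pow_left₀ hg0.le hg4 2
    calc b * x ^ 5 * (24 * gmax ^ 2) ≤ b * x ^ 5 * (24 * (4 * x) ^ 2) := by gcongr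
      _ = a * x ^ 7 := by rw [hb]; ring
      _ ≤ _ := hL
  have h2e : (2:ℝ) ≤ Real.exp 1 := by have := Real.add_one_le_exp (1:ℝ); linarith
  have hn1e : (n:ℝ) + 1 ≤ Real.exp x := by
    have : n + 1 ≤ 2 ^ ℓ := hn2
    calc (n:ℝ) + 1 ≤ 2 ^ ℓ := by exact_mod_cast this
      _ ≤ (Real.exp 1) ^ ℓ := pow_le_pow_left₀ (by norm_num) h2e _
      _ = _ := by rw [← Real.exp_nat_mul, mul_one]
  have hMx : M ≤ Real.exp (-x ^ 4) := by
    have e1 : (2:ℝ) ^ (gmax * gmax) ≤ Real.exp (16 * x ^ 2) := by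
      calc (2:ℝ) ^ (gmax * gmax) ≤ (Real.exp 1) ^ (gmax * gmax) :=
            pow_le_pow_left₀ (by norm_num) h2e _
        _ = Real.exp (gmax * gmax) := by rw [← Real.exp_nat_mul, mul_one]; push_cast; rfl
        _ ≤ _ := by
          apply Real.exp_le_exp.2
          nlinarith
    have e2 : ((n:ℝ) + 1) ^ ((d + 1) * gmax) ≤ Real.exp (4 * (d + 1) * x ^ 2) := by
      calc ((n:ℝ) + 1) ^ ((d + 1) * gmax) ≤ (Real.exp x) ^ ((d + 1) * gmax) :=
            pow_le_pow_left₀ (by positivity) hn1e _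
        _ = Real.exp ((d + 1) * gmax * x) := by rw [← Real.exp_nat_mul]; push_cast; rfl
        _ ≤ _ := by
          apply Real.exp_le_exp.2
          have : ((d:ℝ) + 1) * x * gmax ≤ ((d:ℝ) + 1) * x * (4 * x) :=
            mul_le_mul_of_nonneg_left hg4 (by positivity)
          linarith
    rw [hM]
    calc _ ≤ Real.exp (16 * x ^ 2) * Real.exp (4 * (d + 1) * x ^ 2) * Real.exp (-(b * x ^ 5)) := by
          gcongr
      _ = Real.exp (C4 * x ^ 2 - b * x ^ 5) := by
          rw [← Real.exp_add, ← Real.exp_add, hC4]; congr 1; ring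
      _ ≤ _ := by
          apply Real.exp_le_exp.2
          have e3 : (1 + C4) * x ^ 4 ≤ x * b * x ^ 4 :=
            mul_le_mul_of_nonneg_right h2 (by positivity)
          have e4 : x ^ 2 ≤ x ^ 4 := pow_le_pow_right₀ (by linarith) (by norm_num)
          have e5 : C4 * x ^ 2 ≤ C4 * x ^ 4 := mul_le_mul_of_nonneg_left e4 hC4p.le
          linarith [show x * b * x ^ 4 = b * x ^ 5 by ring]
  have hM0 : 0 ≤ M := by rw [hM]; positivity
  have hxe : x ≤ Real.exp x := by have := Real.add_one_le_exp x; linarith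
  have hx4 : 6 * x ≤ x ^ 4 := by
    have : 125 ≤ x ^ 3 := by
      calc (125:ℝ) = 5 ^ 3 := by norm_num
        _ ≤ _ := pow_le_pow_left₀ (by norm_num) h1 3
    nlinarith
  refine ⟨hKpos, hgK, ?_, ?_, ?_⟩
  · refine hMx.trans ?_
    rw [Real.exp_le_one_iff]
    have : 0 ≤ x ^ 4 := by positivity
    linarith
  · have e1 : ((gmax:ℝ) + 1) ≤ 5 * x := by linarith
    have e2 : (K:ℝ) + 1 ≤ Real.exp x := by
      refine le_trans ?_ hn1e
      have : (K:ℝ) ≤ n := by exact_mod_cast hKn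
      linarith
    calc ((gmax:ℝ) + 1) * (K + 1) * N * M
        ≤ (5 * x) * Real.exp x * (C1 * x ^ 2) * Real.exp (-x ^ 4) := by gcongr
      _ = (5 * C1) * x ^ 3 * (Real.exp x * Real.exp (-x ^ 4)) := by ring
      _ ≤ Real.exp x * (Real.exp x) ^ 3 * (Real.exp x * Real.exp (-x ^ 4)) := by
          gcongr
          exact h5.trans hxe
      _ = Real.exp (5 * x - x ^ 4) := by
          rw [← Real.exp_nat_mul, ← Real.exp_add, ← Real.exp_add, ← Real.exp_add]
          congr 1; push_cast; ring
      _ ≤ _ := by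
          apply Real.exp_le_exp.2
          linarith
  · have e1 : ((gmax:ℝ) + 1) ≤ 5 * x := by linarith
    have e3 : 5 * x ≤ Real.exp x * Real.exp x := by
      calc 5 * x ≤ x * x := by nlinarith
        _ ≤ _ := by gcongr
    have e4 : (2:ℝ) ^ n ≤ Real.exp n := by
      calc (2:ℝ) ^ n ≤ (Real.exp 1) ^ n := pow_le_pow_left₀ (by norm_num) h2e _
        _ = _ := by rw [← Real.exp_nat_mul, mul_one]
    have e5 : M ^ K ≤ Real.exp (-(4 * n)) := by
      calc M ^ K ≤ (Real.exp (-x ^ 4)) ^ K := pow_le_pow_left₀ hM0 hMx _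
        _ = Real.exp (K * (-x ^ 4)) := by rw [← Real.exp_nat_mul]
        _ ≤ _ := by
          apply Real.exp_le_exp.2
          have e6 : 4 * (n:ℝ) ≤ x * c5 * n := mul_le_mul_of_nonneg_right h4 hnr.le
          have e7 : x * (c5 * n) ≤ x * (x ^ 3 * K) := mul_le_mul_of_nonneg_left hKx hx0.le
          nlinarith
    calc ((gmax:ℝ) + 1) * 2 ^ n * M ^ K
        ≤ (Real.exp x * Real.exp x) * Real.exp n * Real.exp (-(4 * n)) := by
          gcongr
          exact e1.trans e3
      _ = Real.exp (2 * x - 3 * n) := by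
          rw [← Real.exp_add, ← Real.exp_add, ← Real.exp_add]
          congr 1; ring
      _ ≤ _ := by
          apply Real.exp_le_exp.2
          linarith

end PartG1

section PartG2

open MeasureTheory Filter Topology

set_option linter.unusedSectionVars false

/-! ### Final assembly -/

lemma gnp_eq (n : ℕ) {p : ℝ} (h0 : 0 ≤ p) (h1 : p ≤ 1) (S : Set (Sym2 (Fin n) → Bool)) :
    gnp n p S = ENNReal.ofReal (Pr p S) := by
  classical
  have hmin : min (ENNReal.ofReal p) 1 = ENNReal.ofReal p :=
    min_eq_left (by rw [← ENNReal.ofReal_one]; exact ENNReal.ofReal_le_ofReal h1)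
  have hb : ∀ b : Bool, bernoulliMeasure p {b} = ENNReal.ofReal (bw p b) := by
    intro b
    unfold bernoulliMeasure bw
    rw [hmin]
    cases b
    · simp [ENNReal.ofReal_sub _ h0]
    · simp
  have hfin : IsFiniteMeasure (bernoulliMeasure p) := by
    constructor
    rw [← Set.toFinite (Set.univ : Set Bool) |>.coe_toFinset]
    rw [← MeasureTheory.sum_measure_singleton]
    refine ENNReal.sum_lt_top.2 fun b _ => ?_
    rw [hb]
    exact ENNReal.ofReal_lt_top
  have hsing : ∀ ω : Sym2 (Fin n) → Bool, gnp n p {ω} = ENNReal.ofReal (Wt p ω) := by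
    intro ω
    unfold gnp Wt
    rw [Measure.pi_singleton, ENNReal.ofReal_prod_of_nonneg (fun e _ => bw_nonneg h0 h1 _)]
    exact Finset.prod_congr rfl fun e _ => hb _
  have hS : S = ((Finset.univ.filter (fun ω => ω ∈ S) : Finset (Sym2 (Fin n) → Bool)) : Set _) := by
    ext; simp
  conv_lhs => rw [hS]
  rw [← MeasureTheory.sum_measure_singleton, Finset.sum_congr rfl (fun ω _ => hsing ω),
    ← ENNReal.ofReal_sum_of_nonneg (fun ω _ => Wt_nonneg h0 h1 ω)]
  congr 1
  unfold Pr Ex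
  rw [Finset.sum_filter]
  exact Finset.sum_congr rfl fun ω _ => by split_ifs <;> simp_all

lemma Pr_compl {n : ℕ} (p : ℝ) (S : Set (Sym2 (Fin n) → Bool)) : Pr p S = 1 - Pr p Sᶜ := by
  classical
  rw [← Ex_one (E := Sym2 (Fin n)) p]
  unfold Pr
  rw [← Ex_sub]
  congr 1
  ext ω
  by_cases h : ω ∈ S <;> simp [h]

lemma exists_reserves (n N s : ℕ) (h : N * s ≤ n) : ∃ R : Fin N → Finset (Fin n),
    (∀ a, (R a).card = s) ∧ ∀ a b, a ≠ b → Disjoint (R a) (R b) := by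
  classical
  let f : Fin N × Fin s → Fin n := fun q => Fin.castLE h (finProdFinEquiv q)
  have hf : Function.Injective f := (Fin.castLE_injective h).comp finProdFinEquiv.injective
  refine ⟨fun a => Finset.univ.image (fun j => f (a, j)), ?_, ?_⟩
  · intro a
    rw [Finset.card_image_of_injective]
    · simp
    · intro i j hij
      simpa using hf hij
  · intro a b hab
    rw [Finset.disjoint_left]
    intro v hv hv'
    obtain ⟨i, -, rfl⟩ := Finset.mem_image.1 hv
    obtain ⟨j, -, hj⟩ := Finset.mem_image.1 hv'
    have := hf hj
    exact hab (by simpa using (congrArg Prod.fst this).symm)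

lemma exists_idx (T ℓ : ℕ) (hT : 0 < T) (hℓ : 0 < ℓ) : ∃ r : ℕ → ℕ → Fin (T * ℓ),
    ∀ t < T, ∀ t' < T, ∀ a < ℓ, ∀ a' < ℓ, r t a = r t' a' → t = t' ∧ a = a' := by
  refine ⟨fun t a => if h : t < T ∧ a < ℓ then finProdFinEquiv (⟨t, h.1⟩, ⟨a, h.2⟩) else
    ⟨0, Nat.mul_pos hT hℓ⟩, ?_⟩
  intro t ht t' ht' a ha a' ha' he
  simp only [ht, ht', ha, ha', and_self, dif_pos] at he
  have := finProdFinEquiv.injective he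
  simpa using this

open Classical in
lemma deg_le_of_maxDeg {m Δ : ℕ} (H : SimpleGraph (Fin m)) (h : maxDeg H ≤ Δ) (x : Fin m) :
    (Finset.univ.filter (H.Adj x)).card ≤ Δ := by
  refine le_trans ?_ h
  unfold maxDeg
  refine le_trans ?_ (Finset.le_sup (f := fun v => (H.neighborSet v).ncard) (Finset.mem_univ x))
  rw [← Set.ncard_coe_finset]
  refine le_of_eq (congrArg _ ?_)
  ext y
  simp

/-- The lower bound on the probability of universality for fixed `n`. -/
lemma univ_of_PR {n d ℓ T K : ℕ} {ε : ℝ} (hd2 : 2 ≤ d) (hK : 1 ≤ K)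
    (hT : T = (ℓ + 3) * ((d + 1) * (d + 1) + (d + 1) + 1) + (2 * ℓ + 2))
    (hn : 0 < n) (hn2 : n < 2 ^ ℓ) (hKn : K ≤ n) (hε1 : 0 < ε)
    (hKε : 4 * ((T * ℓ : ℕ) : ℝ) * ((2 * ℓ + 2 : ℕ) : ℝ) * K ≤ ε * n)
    (R : Fin (T * ℓ) → Finset (Fin n)) (hRc : ∀ a, (R a).card = 2 * ((2 * ℓ + 2) * K))
    (hRd : ∀ a b, a ≠ b → Disjoint (R a) (R b)) (G : SimpleGraph (Fin n))
    (hPR : PR G d (2 * ℓ + 2) K (T * ℓ) R) :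
    ∀ m : ℕ, (m : ℝ) ≤ (1 - ε) * n → ∀ H : SimpleGraph (Fin m),
        maxDeg H ≤ d + 1 → ContainsCopy H G := by
  intro m hm H hH
  have hnr : (0:ℝ) < n := by exact_mod_cast hn
  have hmn : m ≤ n := by
    have : (m:ℝ) ≤ n := by nlinarith
    exact_mod_cast this
  have hl : 0 < ℓ := by
    rcases Nat.eq_zero_or_pos ℓ with h | h
    · subst h; simp at hn2; omega
    · exact h
  have hTpos : 0 < T := by rw [hT]; omega
  obtain ⟨r, hr⟩ := exists_idx T ℓ hTpos hl
  have hreach := reach_univ H (ℓ := ℓ) hd2 (fun x => by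
    simpa using deg_le_of_maxDeg H hH x) (by simpa using lt_of_le_of_lt hmn hn2)
  rw [← hT] at hreach
  refine embed_of_reach hPR hK (lt_of_le_of_lt hKn hn2) hn r hRc hr hRd ?_ hreach
  have hcast : (((2 * ℓ + 2) * K + m + T * ℓ * (2 * ((2 * ℓ + 2) * K)) : ℕ) : ℝ) ≤ n := by
    have hN1 : 1 ≤ T * ℓ := Nat.mul_pos hTpos hl
    have hN1r : (1:ℝ) ≤ ((T * ℓ : ℕ):ℝ) := by exact_mod_cast hN1
    have hG0 : (0:ℝ) ≤ ((2 * ℓ + 2 : ℕ):ℝ) * K := by positivity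
    generalize T * ℓ = N at *
    generalize 2 * ℓ + 2 = g at *
    push_cast
    have e1 := mul_le_mul_of_nonneg_right hN1r hG0
    nlinarith
  simp only [Fintype.card_fin]
  exact_mod_cast hcast

end PartG2

section PartG3

open MeasureTheory Filter Topology

set_option linter.unusedSectionVars false

lemma final_eventually (ε : ℝ) (hε : 0 < ε) (hε1 : ε ≤ 1) (d : ℕ) (hd2 : 2 ≤ d)
    (p : ℕ → ℝ) (hp : ∀ n, 0 ≤ p n ∧ p n ≤ 1)
    (hcond : Tendsto (fun n : ℕ =>
        p n * (n : ℝ) ^ ((1 : ℝ) / (d : ℝ)) / Real.log n ^ 5) atTop atTop) :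
    ∀ᶠ n : ℕ in atTop, 1 - 2 * Real.exp (-((Nat.log 2 n + 1 : ℕ) : ℝ)) ≤ Pr (p n)
      {ω : Sym2 (Fin n) → Bool | ∀ m : ℕ, (m : ℝ) ≤ (1 - ε) * n → ∀ H : SimpleGraph (Fin m),
        maxDeg H ≤ d + 1 → ContainsCopy H (graphOf ω)} := by
  set c := (d + 1) * (d + 1) + (d + 1) + 1 with hc
  set C1 := 4 * c + 4 with hC1
  have hC1p : (0:ℝ) < C1 := by positivity
  have hlog : Tendsto (fun n : ℕ => Nat.log 2 n + 1) atTop atTop := by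
    refine tendsto_atTop.2 fun b => ?_
    filter_upwards [eventually_ge_atTop (2 ^ b)] with n hn
    have := Nat.le_log_of_pow_le (by norm_num) hn
    omega
  have hpow : ∀ᶠ ℓ : ℕ in atTop, 64 * (C1:ℝ) * (ℓ:ℝ) ^ 3 ≤ ε * 2 ^ ℓ := by
    have h1 := tendsto_pow_const_div_const_pow_of_one_lt 3 (r := (2:ℝ)) (by norm_num)
    have h2 := h1.eventually (gt_mem_nhds (show (0:ℝ) < ε / (64 * C1) by positivity))
    filter_upwards [h2] with ℓ h
    rw [div_lt_div_iff₀ (by positivity) (by positivity)] at h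
    linarith
  have hlogR : Tendsto (fun n : ℕ => Real.log n) atTop atTop :=
    Real.tendsto_log_atTop.comp tendsto_natCast_atTop_atTop
  filter_upwards [hlog.eventually (numeric d C1 (by omega) ε hε), hlog.eventually hpow,
    hcond.eventually_ge_atTop 1, hlogR.eventually_ge_atTop 1, eventually_ge_atTop 4]
    with n hnum hpw hco hl1 hn4
  have hnlt : n < 2 ^ (Nat.log 2 n + 1) := Nat.lt_pow_succ_log_self (by norm_num) n
  have hnge : 2 ^ (Nat.log 2 n) ≤ n := Nat.pow_log_le_self 2 (by omega)
  have hln : Nat.log 2 n + 1 ≤ n := by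
    have := Nat.log_lt_self 2 (x := n) (by omega)
    omega
  have hl0 : ((Nat.log 2 n + 1 : ℕ):ℝ) ≤ 3 * Real.log n := by
    have e1 : ((2:ℝ) ^ (Nat.log 2 n)) ≤ n := by exact_mod_cast hnge
    have e2 := Real.log_le_log (by positivity) e1
    rw [Real.log_pow] at e2
    have e3 := Real.log_two_gt_d9
    push_cast
    have e4 : (0:ℝ) ≤ (Nat.log 2 n : ℝ) := Nat.cast_nonneg _
    nlinarith
  have hpw2 : 32 * (C1:ℝ) * ((Nat.log 2 n + 1 : ℕ):ℝ) ^ 3 ≤ ε * n := by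
    have e1 : ((2:ℝ) ^ (Nat.log 2 n)) ≤ n := by exact_mod_cast hnge
    rw [pow_succ (2:ℝ)] at hpw
    nlinarith
  have hl1' : 1 ≤ Nat.log 2 n + 1 := by omega
  generalize Nat.log 2 n + 1 = ℓ at *
  have hnr : (0:ℝ) < n := by exact_mod_cast (show 0 < n by omega)
  have hlr : (1:ℝ) ≤ ℓ := by exact_mod_cast hl1'
  have hlogp : (0:ℝ) < Real.log n ^ 5 := by positivity
  rw [le_div_iff₀ hlogp, one_mul] at hco
  have hp0 : 0 < p n := by
    rcases (hp n).1.lt_or_eq with h | h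
    · exact h
    · rw [← h, zero_mul] at hco
      linarith
  have hpd : (ℓ:ℝ) ^ 10 ≤ 3 ^ 10 * (n * p n ^ d) := by
    have e1 : (Real.log n ^ 5) ^ d ≤ n * p n ^ d := by
      have := pow_le_pow_left₀ hlogp.le hco d
      rw [mul_pow, one_div, Real.rpow_inv_natCast_pow hnr.le (by omega)] at this
      linarith
    have e2 : (Real.log n ^ 5) ^ 2 ≤ (Real.log n ^ 5) ^ d :=
      pow_le_pow_right₀ (one_le_pow₀ hl1) hd2
    calc (ℓ:ℝ) ^ 10 ≤ (3 * Real.log n) ^ 10 := pow_le_pow_left₀ (by positivity) hl0 10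
      _ = 3 ^ 10 * (Real.log n ^ 5) ^ 2 := by ring
      _ ≤ _ := by gcongr; exact e2.trans e1
  -- parameters
  obtain ⟨T, hT⟩ : ∃ T, T = (ℓ + 3) * c + (2 * ℓ + 2) := ⟨_, rfl⟩
  have hTle : T ≤ C1 * ℓ := by
    rw [hT, hC1]
    nlinarith
  have hTpos : 1 ≤ T := by rw [hT]; omega
  have hN : T * ℓ ≤ C1 * ℓ ^ 2 := by
    calc T * ℓ ≤ C1 * ℓ * ℓ := Nat.mul_le_mul_right _ hTle
      _ = _ := by ring
  have hNr : ((T * ℓ : ℕ):ℝ) ≤ C1 * (ℓ:ℝ) ^ 2 := by exact_mod_cast hN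
  have hN1 : (1:ℝ) ≤ ((T * ℓ : ℕ):ℝ) := by
    exact_mod_cast Nat.mul_pos hTpos hl1'
  have hg : ((2 * ℓ + 2 : ℕ):ℝ) ≤ 4 * ℓ := by push_cast; linarith
  have hg1 : (1:ℝ) ≤ ((2 * ℓ + 2 : ℕ):ℝ) := by push_cast; linarith
  set D : ℝ := 4 * ((T * ℓ : ℕ):ℝ) * ((2 * ℓ + 2 : ℕ):ℝ) with hD
  have hD1 : 1 ≤ D := by nlinarith
  have hDle : D ≤ 16 * C1 * (ℓ:ℝ) ^ 3 := by
    calc D ≤ 4 * (C1 * (ℓ:ℝ) ^ 2) * (4 * ℓ) := by rw [hD]; gcongr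
      _ = _ := by ring
  set K := ⌊ε * n / D⌋₊ with hK
  have hKle : (K:ℝ) ≤ ε * n / D := Nat.floor_le (by positivity)
  have hKD : D * K ≤ ε * n := by
    rw [le_div_iff₀ (by positivity)] at hKle
    linarith
  have hKn : K ≤ n := by
    have : (K:ℝ) ≤ n := by
      refine hKle.trans ?_
      rw [div_le_iff₀ (by positivity)]
      nlinarith
    exact_mod_cast this
  have hKlow : ε * n ≤ 32 * C1 * (ℓ:ℝ) ^ 3 * K := by
    have e1 : ε * n / D < K + 1 := Nat.lt_floor_add_one _
    rw [div_lt_iff₀ (by positivity)] at e1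
    have e2 : ((K:ℝ) + 1) * D ≤ (K + 1) * (16 * C1 * (ℓ:ℝ) ^ 3) := by gcongr
    nlinarith
  obtain ⟨hKpos, hgK, hM1, hδ1, hδ2⟩ := hnum n K (2 * ℓ + 2) (T * ℓ) (p n) (by omega) hln hnlt hKn
    rfl hN hKlow hp0 hpd _ rfl
  have hres : T * ℓ * (2 * ((2 * ℓ + 2) * K)) ≤ n := by
    have : ((T * ℓ * (2 * ((2 * ℓ + 2) * K)) : ℕ):ℝ) ≤ n := by
      rw [Nat.cast_mul, Nat.cast_mul 2, Nat.cast_mul (2 * ℓ + 2)]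
      have e1 : (0:ℝ) ≤ D * K := by positivity
      have e2 : ε * n ≤ n := by nlinarith
      rw [hD] at e1 hKD
      push_cast at e1 hKD ⊢
      linarith
    exact_mod_cast this
  obtain ⟨R, hRc, hRd⟩ := exists_reserves n (T * ℓ) _ hres
  have hbad := notPR_prob (n := n) (d := d) hp0 (hp n).2 hKpos hgK R _ _ rfl hM1 hδ1 hδ2
  rw [Pr_compl]
  have hmono : Pr (p n) {ω : Sym2 (Fin n) → Bool | ∀ m : ℕ, (m : ℝ) ≤ (1 - ε) * n → ∀ H : SimpleGraph (Fin m),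
        maxDeg H ≤ d + 1 → ContainsCopy H (graphOf ω)}ᶜ ≤
      Pr (p n) {ω : Sym2 (Fin n) → Bool | ¬ PR (graphOf ω) d (2 * ℓ + 2) K (T * ℓ) R} := by
    refine Pr_mono (hp n).1 (hp n).2 ?_
    intro ω hω hPR
    exact hω (univ_of_PR hd2 hKpos hT (by omega) hnlt hKn hε hKD R hRc hRd _ hPR)
  linarith

end PartG3

/-- **Conlon–Ferber–Nenadov–Škorić theorem.** For every `ε > 0` and `Δ ≥ 3`, if
`p·n^{1/(Δ-1)}/(log n)⁵ → ∞` then a.a.s. `G(n,p)` is universal for `𝓗((1-ε)n, Δ)`, i.e. it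
simultaneously contains every graph on at most `(1-ε)n` vertices with maximum degree at
most `Δ`. -/
theorem stmt_13 (ε : ℝ) (hε : 0 < ε) (Δ : ℕ) (hΔ : 3 ≤ Δ)
    (p : ℕ → ℝ) (hp : ∀ n, 0 ≤ p n ∧ p n ≤ 1)
    (hcond : Tendsto (fun n : ℕ =>
        p n * (n : ℝ) ^ ((1 : ℝ) / ((Δ : ℝ) - 1)) / Real.log n ^ 5) atTop atTop) :
    Tendsto (fun n : ℕ => gnp n (p n)
      {ω | ∀ m : ℕ, (m : ℝ) ≤ (1 - ε) * n → ∀ H : SimpleGraph (Fin m),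
        maxDeg H ≤ Δ → ContainsCopy H (graphOf ω)}) atTop (𝓝 1) := by
  obtain ⟨d, rfl⟩ : ∃ d, Δ = d + 1 := ⟨Δ - 1, by omega⟩
  have hd2 : 2 ≤ d := by omega
  have hcast : (((d + 1 : ℕ):ℝ) - 1) = d := by push_cast; ring
  rw [hcast] at hcond
  have hev := final_eventually (min ε 1) (lt_min hε one_pos) (min_le_right _ _) d hd2 p hp hcond
  simp_rw [fun n => gnp_eq n (hp n).1 (hp n).2]
  rw [← ENNReal.ofReal_one]
  refine ENNReal.tendsto_ofReal ?_
  have hlow : Tendsto (fun n : ℕ => 1 - 2 * Real.exp (-((Nat.log 2 n + 1 : ℕ) : ℝ))) atTop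
      (𝓝 1) := by
    have hlog : Tendsto (fun n : ℕ => Nat.log 2 n + 1) atTop atTop := by
      refine tendsto_atTop.2 fun b => ?_
      filter_upwards [eventually_ge_atTop (2 ^ b)] with n hn
      have := Nat.le_log_of_pow_le (by norm_num) hn
      omega
    have h1 : Tendsto (fun n : ℕ => Real.exp (-((Nat.log 2 n + 1 : ℕ) : ℝ))) atTop (𝓝 0) :=
      Real.tendsto_exp_neg_atTop_nhds_zero.comp (tendsto_natCast_atTop_atTop.comp hlog)
    have h2 := (h1.const_mul 2).const_sub 1
    simpa using h2
  refine tendsto_of_tendsto_of_tendsto_of_le_of_le' hlow tendsto_const_nhds ?_ ?_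
  · filter_upwards [hev] with n hn
    refine hn.trans (Pr_mono (hp n).1 (hp n).2 ?_)
    intro ω hω m hm H hH
    refine hω m (hm.trans ?_) H hH
    have : min ε 1 ≤ ε := min_le_left _ _
    have hn0 : (0:ℝ) ≤ n := Nat.cast_nonneg n
    nlinarith
  · refine Eventually.of_forall fun n => ?_
    rw [Pr_compl]
    have := Pr_nonneg (hp n).1 (hp n).2 {ω : Sym2 (Fin n) → Bool | ∀ m : ℕ, (m : ℝ) ≤ (1 - ε) * n → ∀ H : SimpleGraph (Fin m),
        maxDeg H ≤ d + 1 → ContainsCopy H (graphOf ω)}ᶜ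
    linarith
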